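/- arXiv:1812.06058 — 2 statements merged into one kernel-verified Lean document; each statement's English description precedes it below -/
import Mathlib

section
/- The space O(F₂) of bi-invariant positive cones of the free group F₂ on two generators is homeomorphic to the Cantor set (equivalently, to the product space ℕ → {0,1}). -/
/-- A subset `P` of a group `G` is a (left-invariant) positive cone if `P · P ⊆ P`
and for every `g ∈ G` exactly one of `g = 1`, `g ∈ P`, `g⁻¹ ∈ P` holds. -/
def IsPosCone {G : Type*} [Group G] (P : Set G) : Prop :=
  (∀ a ∈ P, ∀ b ∈ P, a * b ∈ P) ∧
  ∀ g : G, (g = 1 ∧ g ∉ P ∧ g⁻¹ ∉ P) ∨ (g ∈ P ∧ g ≠ 1 ∧ g⁻¹ ∉ P) ∨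
    (g⁻¹ ∈ P ∧ g ≠ 1 ∧ g ∉ P)

/-- A bi-invariant positive cone: a positive cone that is also conjugation-invariant. -/
def IsBiPosCone {G : Type*} [Group G] (P : Set G) : Prop :=
  IsPosCone P ∧ ∀ g : G, ∀ p ∈ P, g * p * g⁻¹ ∈ P

/-- The space `O(G)` of bi-invariant positive cones of `G`, topologized as a
subspace of the product space `{0,1}^G` via characteristic functions. -/
abbrev OSpace (G : Type*) [Group G] : Type _ :=
  {f : G → Bool // IsBiPosCone {g | f g = true}}

open FreeGroup (of lift freeGroupCongr)

section Cantor

/-- Some point of `X` first differs from `x` at index `n`. -/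
def Branches (X : Set (ℕ → Bool)) (x : ℕ → Bool) (n : ℕ) : Prop :=
  ∃ y ∈ X, (∀ i < n, y i = x i) ∧ y n ≠ x n

theorem Branches.congr {X : Set (ℕ → Bool)} {x x' : ℕ → Bool} (hx : x ∈ X) {n : ℕ}
    (h : ∀ i < n, x i = x' i) (hb : Branches X x n) : Branches X x' n := by
  obtain ⟨y, hy, h1, h2⟩ := hb
  by_cases e : x n = x' n
  · exact ⟨y, hy, fun i hi => (h1 i hi).trans (h i hi), e ▸ h2⟩
  · exact ⟨x, hx, h, e⟩

theorem Branches.nth_congr {X : Set (ℕ → Bool)} {x x' : ℕ → Bool} (hx : x ∈ X) (hx' : x' ∈ X)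
    (hinf : {n | Branches X x n}.Infinite) {k : ℕ}
    (h : ∀ i < Nat.nth (Branches X x) k, x i = x' i) :
    Nat.nth (Branches X x') k = Nat.nth (Branches X x) k := by
  classical
  have key : ∀ i ≤ Nat.nth (Branches X x) k, (Branches X x' i ↔ Branches X x i) := fun i hi =>
    ⟨Branches.congr hx' fun j hj => (h j (hj.trans_le hi)).symm,
      Branches.congr hx fun j hj => h j (hj.trans_le hi)⟩
  have hb : Branches X x' (Nat.nth (Branches X x) k) :=
    (key _ le_rfl).2 (Nat.nth_mem_of_infinite hinf k)
  have hc : Nat.count (Branches X x') (Nat.nth (Branches X x) k) = k := by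
    rw [← Nat.count_nth_of_infinite hinf k]
    conv_lhs => rw [Nat.count_nth_of_infinite hinf k]
    rw [Nat.count_eq_card_filter_range, Nat.count_eq_card_filter_range]
    congr 1
    ext i
    simp only [Finset.mem_filter, Finset.mem_range, and_congr_right_iff]
    exact fun hi => key i hi.le
  conv_lhs => rw [← hc]
  exact Nat.nth_count hb

/-- A nonempty closed subset of Cantor space without isolated points is homeomorphic to
Cantor space. -/
theorem nonempty_homeomorph_cantor_of_isClosed {X : Set (ℕ → Bool)} (hc : IsClosed X)
    (hne : X.Nonempty) (hp : ∀ x ∈ X, ∀ n, ∃ y ∈ X, y ≠ x ∧ ∀ i < n, y i = x i) :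
    Nonempty (X ≃ₜ (ℕ → Bool)) := by
  classical
  have hinf : ∀ x ∈ X, {n | Branches X x n}.Infinite := by
    intro x hx
    refine Set.infinite_of_forall_exists_gt fun n => ?_
    obtain ⟨y, hy, hyx, hn⟩ := hp x hx (n + 1)
    have hd : ∃ i, y i ≠ x i := Function.ne_iff.1 hyx
    exact ⟨Nat.find hd, ⟨y, hy, fun i hi => not_not.1 (Nat.find_min hd hi), Nat.find_spec hd⟩,
      not_le.1 fun hle => Nat.find_spec hd (hn _ (Nat.lt_succ_of_le hle))⟩
  let f : X → ℕ → Bool := fun x k => x.1 (Nat.nth (Branches X x.1) k)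
  have hf : Continuous f := by
    refine continuous_pi fun k => continuous_discrete_rng.2 fun b => ?_
    refine isOpen_iff_mem_nhds.2 fun x hx => ?_
    have hU : {x' : X | ∀ i ∈ Set.Iic (Nat.nth (Branches X x.1) k), x'.1 i = x.1 i} ∈ nhds x := by
      simp only [Set.ofPred_forall]
      refine (Filter.biInter_mem (Set.finite_Iic _)).2 fun i _ => ?_
      have hci : Continuous fun x' : X => x'.1 i := (continuous_apply i).comp continuous_subtype_val
      exact hci.continuousAt.preimage_mem_nhds
        ((isOpen_discrete ({x.1 i} : Set Bool)).mem_nhds rfl)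
    refine Filter.mem_of_superset hU fun x' hx' => ?_
    have e := Branches.nth_congr x.2 x'.2 (hinf _ x.2) (k := k)
      fun i hi => (hx' i hi.le).symm
    have : f x' k = f x k := by
      change x'.1 _ = x.1 _
      rw [e]
      exact hx' _ (Set.mem_Iic.2 le_rfl)
    exact this.trans hx
  have hinj : Function.Injective f := by
    intro x x' hxx
    by_contra hne'
    have hd : ∃ i, x'.1 i ≠ x.1 i := Function.ne_iff.1 fun h => hne' (Subtype.ext h.symm)
    have hmin : ∀ i < Nat.find hd, x'.1 i = x.1 i := fun i hi => not_not.1 (Nat.find_min hd hi)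
    have hb : Branches X x.1 (Nat.find hd) := ⟨x'.1, x'.2, hmin, Nat.find_spec hd⟩
    have e := Nat.nth_count hb
    have e' := Branches.nth_congr (k := Nat.count (Branches X x.1) (Nat.find hd)) x.2 x'.2
      (hinf _ x.2) (by rw [e]; exact fun i hi => (hmin i hi).symm)
    have := congrFun hxx (Nat.count (Branches X x.1) (Nat.find hd))
    change x.1 _ = x'.1 _ at this
    rw [e', e] at this
    exact Nat.find_spec hd this.symm
  have hdense : ∀ (g : ℕ → Bool) (m : ℕ), ∃ x : X, ∀ k < m, f x k = g k := by
    intro g m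
    induction m with
    | zero => exact ⟨⟨_, hne.some_mem⟩, by simp⟩
    | succ m ih =>
      obtain ⟨x, hx⟩ := ih
      by_cases e : f x m = g m
      · exact ⟨x, fun k hk => (Nat.lt_succ_iff_lt_or_eq.1 hk).elim (hx k) (fun h => h ▸ e)⟩
      · obtain ⟨y, hy, h1, h2⟩ := Nat.nth_mem_of_infinite (hinf _ x.2) m
        have hk : ∀ k ≤ m, Nat.nth (Branches X y) k = Nat.nth (Branches X x.1) k := fun k hk =>
          Branches.nth_congr x.2 hy (hinf _ x.2) fun i hi =>
            (h1 i (hi.trans_le (Nat.nth_monotone (hinf _ x.2) hk))).symm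
        refine ⟨⟨y, hy⟩, fun k hkm => ?_⟩
        change y (Nat.nth (Branches X y) k) = _
        rw [hk k (Nat.lt_succ_iff.1 hkm)]
        rcases Nat.lt_succ_iff_lt_or_eq.1 hkm with h | rfl
        · rw [h1 _ (Nat.nth_strictMono (hinf _ x.2) h)]
          exact hx k h
        · have e1 : x.1 (Nat.nth (Branches X x.1) k) ≠ g k := e
          revert h2 e1
          generalize y _ = p
          generalize x.1 _ = q
          generalize g k = r
          revert p q r
          decide
  have : CompactSpace X := isCompact_iff_compactSpace.1 hc.isCompact
  have hsurj : Function.Surjective f := by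
    have hcl : IsClosed (Set.range f) := (isCompact_range hf).isClosed
    have : ∀ g, g ∈ Set.range f := by
      intro g
      rw [← hcl.closure_eq]
      choose s hs using hdense g
      refine mem_closure_of_tendsto (f := fun m => f (s m)) (b := Filter.atTop) ?_
        (Filter.Eventually.of_forall fun m => ⟨_, rfl⟩)
      refine tendsto_pi_nhds.2 fun k => ?_
      refine tendsto_const_nhds.congr' ?_
      filter_upwards [Filter.eventually_gt_atTop k] with m hm
      exact (hs m k hm).symm
    exact this
  exact ⟨hf.homeoOfEquivCompactToT2 (f := Equiv.ofBijective f ⟨hinj, hsurj⟩)⟩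

theorem isClosed_setOf_isBiPosCone (G : Type*) [Group G] :
    IsClosed {f : G → Bool | IsBiPosCone {g | f g = true}} := by
  have hev : ∀ g : G, IsClopen {f : G → Bool | f g = true} := fun g =>
    (isClopen_discrete ({true} : Set Bool)).preimage (continuous_apply g)
  have hcl : ∀ g, IsClosed {f : G → Bool | f g = true} := fun g => (hev g).1
  have hop : ∀ g, IsOpen {f : G → Bool | f g = true} := fun g => (hev g).2
  have hncl : ∀ g, IsClosed {f : G → Bool | ¬ f g = true} := fun g => (hop g).isClosed_compl
  have hall : ∀ {p : G → (G → Bool) → Prop}, (∀ g, IsClosed {f | p g f}) →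
      IsClosed {f | ∀ g, p g f} := fun h => by
    rw [Set.ofPred_forall]
    exact isClosed_iInter h
  refine IsClosed.inter (IsClosed.inter ?_ ?_) ?_
  · exact hall fun a => isClosed_imp (hop a) (hall fun b => isClosed_imp (hop b) (hcl _))
  · refine hall fun g => ?_
    refine IsClosed.union ?_ (IsClosed.union ?_ ?_)
    · exact isClosed_const.inter ((hncl _).inter (hncl _))
    · exact (hcl _).inter (isClosed_const.inter (hncl _))
    · exact (hcl _).inter (isClosed_const.inter (hncl _))
  · exact hall fun g => hall fun p => isClosed_imp (hop p) (hcl _)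

/-- If the bi-invariant cones of a countably infinite group exist and none of them is determined
by finitely many of its elements, they form a Cantor space. -/
theorem nonempty_OSpace_homeomorph_cantor {G : Type*} [Group G] [Countable G] [Infinite G]
    (hne : ∃ P : Set G, IsBiPosCone P)
    (hp : ∀ P : Set G, IsBiPosCone P → ∀ S : Set G, S.Finite → S ⊆ P →
      ∃ Q : Set G, IsBiPosCone Q ∧ S ⊆ Q ∧ Q ≠ P) :
    Nonempty (OSpace G ≃ₜ (ℕ → Bool)) := by
  classical
  obtain ⟨e⟩ := nonempty_equiv_of_countable (α := G) (β := ℕ)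
  let H : (G → Bool) ≃ₜ (ℕ → Bool) := Homeomorph.piCongrLeft (Y := fun _ => Bool) e
  have hH : ∀ f i, H f i = f (e.symm i) := fun f i => by
    obtain ⟨g, rfl⟩ := e.surjective i
    rw [Equiv.symm_apply_apply]
    exact Equiv.piCongrLeft_apply_apply (fun _ => Bool) e f g
  have hcone : ∀ {P : Set G}, IsBiPosCone P →
      IsBiPosCone {g | (fun g => decide (g ∈ P)) g = true} := fun h => by simpa using h
  have himg := H.image {f : G → Bool | IsBiPosCone {g | f g = true}}
  obtain ⟨K⟩ := nonempty_homeomorph_cantor_of_isClosed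
    (H.isClosedMap _ (isClosed_setOf_isBiPosCone G))
    (by obtain ⟨P, hP⟩ := hne; exact ⟨_, Set.mem_image_of_mem _ (hcone hP)⟩) (by
      rintro _ ⟨f, hf, rfl⟩ n
      set P := {g | f g = true} with hPdef
      have hf' : IsBiPosCone P := hf
      have hmem : ∀ g, g ∈ P ↔ f g = true := fun g => Iff.rfl
      obtain ⟨Q, hQ, hS, hQP⟩ := hp P hf'
        {g | g ∈ P ∧ (e g < n ∨ e g⁻¹ < n)} (by
          have : ((e ⁻¹' Set.Iio n) ∪ (Inv.inv ⁻¹' (e ⁻¹' Set.Iio n))).Finite := by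
            have h1 := (Set.finite_Iio n).preimage e.injective.injOn
            exact h1.union (h1.preimage inv_injective.injOn)
          exact this.subset fun g hg => hg.2)
        (fun g hg => hg.1)
      refine ⟨_, Set.mem_image_of_mem _ (hcone hQ), ?_, ?_⟩
      · intro h
        refine hQP ?_
        have h' := H.injective h
        ext g
        have := congrFun h' g
        rw [hmem, ← this]
        simp
      · intro i hi
        obtain ⟨g, rfl⟩ := e.surjective i
        simp only [hH, Equiv.symm_apply_apply]
        have hP3 := hf'.1.2 g
        have hQ3 := hQ.1.2 g
        have a1 : g ∈ P → g ∈ Q := fun h => hS ⟨h, Or.inl hi⟩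
        have a2 : g⁻¹ ∈ P → g⁻¹ ∈ Q := fun h => hS ⟨h, Or.inr (by simpa using hi)⟩
        have : g ∈ Q ↔ f g = true := by rw [← hmem]; tauto
        rw [Bool.eq_iff_iff]
        simpa using this)
  exact ⟨himg.trans K⟩

end Cantor

theorem FreeGroup.induction_mul_left {α : Type*} {p : FreeGroup α → Prop} (one : p 1)
    (mul : ∀ a w, p w → p (of a * w)) (inv_mul : ∀ a w, p w → p ((of a)⁻¹ * w))
    (w : FreeGroup α) : p w := by
  obtain ⟨L, rfl⟩ := Quot.exists_rep w
  induction L with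
  | nil => exact one
  | cons x L ih =>
    obtain ⟨a, _ | _⟩ := x
    · exact inv_mul a _ ih
    · exact mul a _ ih

section Magnus

variable {α : Type*} [DecidableEq α]

/-- Left multiplication by `1 + X a` on noncommutative power series, given by their coefficients. -/
def magnusMul (a : α) (v : List α → ℤ) : List α → ℤ
  | [] => v []
  | b :: u => v (b :: u) + if b = a then v u else 0

/-- Left multiplication by `(1 + X a)⁻¹` on noncommutative power series. -/
def magnusDiv (a : α) (v : List α → ℤ) : List α → ℤ
  | [] => v []
  | b :: u => v (b :: u) - if b = a then magnusDiv a v u else 0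

/-- Left multiplication by `1 + X a` as a permutation. -/
def magnusPerm (a : α) : Equiv.Perm (List α → ℤ) where
  toFun := magnusMul a
  invFun := magnusDiv a
  left_inv v := funext fun u => by
    induction u with
    | nil => rfl
    | cons b u ih => simp [magnusDiv, magnusMul, ih]
  right_inv v := funext fun u => by
    cases u <;> simp [magnusDiv, magnusMul]

/-- The action of the free group on noncommutative power series through the Magnus embedding. -/
def magnusAct : FreeGroup α →* Equiv.Perm (List α → ℤ) := lift magnusPerm

/-- The coefficients of the Magnus expansion of an element of the free group. -/
def magnusCoeff (w : FreeGroup α) : List α → ℤ :=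
  magnusAct w fun u => if u = [] then 1 else 0

theorem magnusAct_of_mul (a : α) (w : FreeGroup α) (v : List α → ℤ) :
    magnusAct (of a * w) v = magnusMul a (magnusAct w v) := by
  rw [map_mul, Equiv.Perm.mul_apply]
  simp [magnusAct, magnusPerm]

theorem magnusAct_inv_of_mul (a : α) (w : FreeGroup α) (v : List α → ℤ) :
    magnusAct ((of a)⁻¹ * w) v = magnusDiv a (magnusAct w v) := by
  rw [map_mul, Equiv.Perm.mul_apply]
  simp only [magnusAct, map_inv, FreeGroup.lift_apply_of]
  rfl

theorem magnusCoeff_of_mul (a : α) (w : FreeGroup α) :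
    magnusCoeff (of a * w) = magnusMul a (magnusCoeff w) := magnusAct_of_mul _ _ _

theorem magnusCoeff_inv_of_mul (a : α) (w : FreeGroup α) :
    magnusCoeff ((of a)⁻¹ * w) = magnusDiv a (magnusCoeff w) := magnusAct_inv_of_mul _ _ _

theorem magnusCoeff_one (u : List α) : magnusCoeff 1 u = if u = [] then 1 else 0 := by
  simp [magnusCoeff]

theorem magnusCoeff_nil (w : FreeGroup α) : magnusCoeff w [] = 1 := by
  induction w using FreeGroup.induction_mul_left with
  | one => rfl
  | mul a w ih => rwa [magnusCoeff_of_mul]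
  | inv_mul a w ih => rwa [magnusCoeff_inv_of_mul]

theorem magnusAct_apply (w : FreeGroup α) (v : List α → ℤ) (u : List α) :
    magnusAct w v u =
      ∑ i ∈ Finset.range (u.length + 1), magnusCoeff w (u.take i) * v (u.drop i) := by
  induction w using FreeGroup.induction_mul_left generalizing u with
  | one =>
    rw [Finset.sum_eq_single 0]
    · simp [magnusCoeff_one]
    · intro i hi h0
      rw [magnusCoeff_one, if_neg, zero_mul]
      simp only [Finset.mem_range] at hi
      rw [List.take_eq_nil_iff]
      rintro (h | rfl)
      · exact h0 h
      · simp at hi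
        exact h0 hi
    · simp
  | mul a w ih =>
    rw [magnusAct_of_mul, magnusCoeff_of_mul]
    cases u with
    | nil => simp [magnusMul, ih]
    | cons b u =>
      rw [List.length_cons, Finset.sum_range_succ', magnusMul, ih, ih, List.length_cons,
        Finset.sum_range_succ']
      by_cases h : b = a <;>
        simp [magnusMul, h, add_mul, Finset.sum_add_distrib, add_right_comm]
  | inv_mul a w ih =>
    rw [magnusAct_inv_of_mul, magnusCoeff_inv_of_mul]
    induction u with
    | nil => simp [magnusDiv, ih]
    | cons b u ihu =>
      rw [List.length_cons, Finset.sum_range_succ', magnusDiv, ih, ihu, List.length_cons,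
        Finset.sum_range_succ']
      by_cases h : b = a <;>
        simp [magnusDiv, h, sub_mul, Finset.sum_sub_distrib, add_sub_right_comm]

theorem magnusCoeff_mul_of_forall (w w' : FreeGroup α) {u : List α} (hu : u ≠ [])
    (h : ∀ s t, s ≠ [] → t ≠ [] → s ++ t = u → magnusCoeff w s = 0 ∨ magnusCoeff w' t = 0) :
    magnusCoeff (w * w') u = magnusCoeff w u + magnusCoeff w' u := by
  have hact : magnusCoeff (w * w') = magnusAct w (magnusCoeff w') := by
    simp [magnusCoeff]
  have hlen : 0 < u.length := List.length_pos_iff.2 hu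
  rw [hact, magnusAct_apply, Finset.sum_range_succ, Finset.sum_eq_single 0]
  · simp [magnusCoeff_nil, add_comm]
  · intro i hi h0
    rw [mul_eq_zero]
    refine h _ _ ?_ ?_ (List.take_append_drop i u)
    · simp [List.take_eq_nil_iff, h0, hu]
    · simpa using hi
  · intro h
    simp at h
    exact absurd h hu

/-- The Magnus expansion of a nontrivial element, computed along the lists without repetition of
consecutive letters: it is nonzero at `a :: u` and at no longer such list. -/
theorem exists_magnusCoeff_ne_zero (L : List (α × Bool)) (x : α × Bool)
    (hL : FreeGroup.IsReduced (x :: L)) :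
    ∃ u : List α, (x.1 :: u).IsChain (· ≠ ·) ∧
      (∃ n : ℤ, 1 ≤ n ∧ magnusCoeff (FreeGroup.mk (x :: L)) u ≠ 0 ∧
        magnusCoeff (FreeGroup.mk (x :: L)) (x.1 :: u) =
          (if x.2 then 1 else -1) * n * magnusCoeff (FreeGroup.mk (x :: L)) u) ∧
      ∀ t : List α, t.IsChain (· ≠ ·) → u.length < t.length →
        magnusCoeff (FreeGroup.mk (x :: L)) t ≠ 0 →
          t.length = u.length + 1 ∧ t.head? = some x.1 := by
  have hhead : ∀ (y : α × Bool) (M : List (α × Bool)) (t : List α), t.head? ≠ some y.1 →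
      magnusCoeff (FreeGroup.mk (y :: M)) t = magnusCoeff (FreeGroup.mk M) t := by
    rintro ⟨a, _ | _⟩ M t ht
    · change magnusCoeff ((of a)⁻¹ * FreeGroup.mk M) t = _
      rw [magnusCoeff_inv_of_mul]
      cases t with
      | nil => rfl
      | cons b t =>
        have : b ≠ a := by simpa using ht
        simp [magnusDiv, this]
    · change magnusCoeff (of a * FreeGroup.mk M) t = _
      rw [magnusCoeff_of_mul]
      cases t with
      | nil => rfl
      | cons b t =>
        have : b ≠ a := by simpa using ht
        simp [magnusMul, this]
  have hcons : ∀ (y : α × Bool) (M : List (α × Bool)) (t : List α), t.head? ≠ some y.1 →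
      magnusCoeff (FreeGroup.mk (y :: M)) (y.1 :: t) = magnusCoeff (FreeGroup.mk M) (y.1 :: t) +
        (if y.2 then 1 else -1) * magnusCoeff (FreeGroup.mk M) t := by
    intro y M t ht
    have := hhead y M t ht
    obtain ⟨a, _ | _⟩ := y
    · change magnusCoeff ((of a)⁻¹ * FreeGroup.mk M) t = _ at this
      change magnusCoeff ((of a)⁻¹ * FreeGroup.mk M) (a :: t) = _
      rw [magnusCoeff_inv_of_mul] at this ⊢
      simp [magnusDiv, this, sub_eq_add_neg]
    · change magnusCoeff (of a * FreeGroup.mk M) (a :: t) = _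
      rw [magnusCoeff_of_mul]
      simp [magnusMul]
  have hne : ∀ {a : α} {t : List α}, (a :: t).IsChain (· ≠ ·) → t.head? ≠ some a := by
    rintro a (_ | ⟨b, t⟩) ht
    · simp
    · simpa [eq_comm] using (List.isChain_cons_cons.1 ht).1
  induction L generalizing x with
  | nil =>
    have hone : ∀ t : List α, t ≠ [] → magnusCoeff (FreeGroup.mk []) t = 0 := fun t ht => by
      rw [← FreeGroup.one_eq_mk, magnusCoeff_one, if_neg ht]
    refine ⟨[], List.isChain_singleton _, ⟨1, le_rfl, ?_, ?_⟩, ?_⟩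
    · simp [magnusCoeff_nil]
    · rw [hcons _ _ _ (by simp), hone _ (by simp), magnusCoeff_nil, magnusCoeff_nil]
      simp
    · intro t ht hlen h0
      rcases t with _ | ⟨a, t⟩
      · simp at hlen
      by_cases ha : a = x.1
      · subst ha
        rw [hcons _ _ _ (hne ht), hone _ (by simp), zero_add] at h0
        by_cases h : t = []
        · simp [h]
        · simp [hone t h] at h0
      · rw [hhead _ _ _ (by simpa using ha), hone _ (by simp)] at h0
        exact absurd rfl h0
  | cons y L ih =>
    obtain ⟨hxy, hL'⟩ := List.isChain_cons_cons.1 hL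
    obtain ⟨u, hu, ⟨n, hn, hR, hS⟩, hlong⟩ := ih y hL'
    by_cases hx : x.1 = y.1
    · have hx2 := hxy hx
      have hux : u.head? ≠ some x.1 := hx ▸ hne hu
      refine ⟨u, hx ▸ hu, ⟨n + 1, by omega, ?_, ?_⟩, ?_⟩
      · rwa [hhead _ _ _ hux]
      · rw [hhead _ _ _ hux, hcons _ _ _ hux, hx, hS, hx2]
        ring
      · intro t ht hlen h0
        by_cases htx : t.head? = some x.1
        · obtain ⟨t, rfl⟩ := List.head?_eq_some_iff.1 htx
          rw [hcons _ _ _ (hne ht)] at h0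
          have htt : t.IsChain (· ≠ ·) := ht.tail
          refine ⟨?_, rfl⟩
          by_contra hlen'
          simp only [List.length_cons] at hlen hlen'
          have h1 : magnusCoeff (FreeGroup.mk (y :: L)) (x.1 :: t) = 0 := by
            by_contra h
            have := (hlong _ ht (by simpa using hlen) h).1
            simp only [List.length_cons] at this
            omega
          have h2 : magnusCoeff (FreeGroup.mk (y :: L)) t = 0 := by
            by_contra h
            exact hne ht (hx ▸ (hlong t htt (by omega) h).2)
          simp [h1, h2] at h0
        · rw [hhead _ _ _ htx] at h0
          exact absurd (hx ▸ (hlong t ht hlen h0).2) htx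
    · have hz : magnusCoeff (FreeGroup.mk (y :: L)) (x.1 :: y.1 :: u) = 0 := by
        by_contra h
        have := (hlong _ (List.isChain_cons_cons.2 ⟨hx, hu⟩) (by simp) h).1
        simp at this
      have hhx : (y.1 :: u).head? ≠ some x.1 := by simpa [eq_comm] using hx
      refine ⟨y.1 :: u, List.isChain_cons_cons.2 ⟨hx, hu⟩, ⟨1, le_rfl, ?_, ?_⟩, ?_⟩
      · rw [hhead _ _ _ hhx, hS]
        refine mul_ne_zero (mul_ne_zero ?_ (by omega)) hR
        split_ifs <;> simp
      · rw [hhead _ _ _ hhx, hcons _ _ _ hhx, hz]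
        simp
      · intro t ht hlen h0
        simp only [List.length_cons] at hlen ⊢
        have ht0 : magnusCoeff (FreeGroup.mk (y :: L)) t = 0 := by
          by_contra h
          have := (hlong _ ht (by omega) h).1
          omega
        by_cases htx : t.head? = some x.1
        · obtain ⟨t, rfl⟩ := List.head?_eq_some_iff.1 htx
          have htt : t.IsChain (· ≠ ·) := ht.tail
          refine ⟨?_, htx⟩
          rw [hcons _ _ _ (hne ht), ht0, zero_add] at h0
          have := right_ne_zero_of_mul h0
          simp only [List.length_cons] at hlen ⊢
          have := (hlong t htt (by omega) this).1
          omega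
        · rw [hhead _ _ _ htx] at h0
          exact absurd ht0 h0

theorem exists_magnusCoeff_ne_zero_of_ne_one {w : FreeGroup α} (hw : w ≠ 1) :
    ∃ u, u ≠ [] ∧ magnusCoeff w u ≠ 0 := by
  have hr := FreeGroup.isReduced_toWord (x := w)
  rcases h : w.toWord with _ | ⟨x, L⟩
  · exact absurd (FreeGroup.toWord_eq_nil_iff.1 h) hw
  · rw [h] at hr
    obtain ⟨u, -, ⟨n, hn, hR, hS⟩, -⟩ := exists_magnusCoeff_ne_zero L x hr
    refine ⟨x.1 :: u, by simp, ?_⟩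
    rw [← FreeGroup.mk_toWord (x := w), h, hS]
    refine mul_ne_zero (mul_ne_zero ?_ (by omega)) hR
    split_ifs <;> simp

end Magnus

section MagnusCone

variable {α : Type*} [LinearOrder α]

/-- The Magnus expansion of `w` has no nonconstant term before `u`. -/
def MagnusVanishes (w : FreeGroup α) (u : List α) : Prop :=
  ∀ t, t ≠ [] → List.Shortlex (· < ·) t u → magnusCoeff w t = 0

theorem MagnusVanishes.of_length_lt {w : FreeGroup α} {u t : List α} (h : MagnusVanishes w u)
    (ht : t ≠ []) (hlen : t.length < u.length) : magnusCoeff w t = 0 :=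
  h t ht (List.Shortlex.of_length_lt hlen)

instance shortlex_isTrans : IsTrans (List α) (List.Shortlex (· < ·)) where
  trans a b c h1 h2 := by
    rw [List.shortlex_def] at *
    rcases h1 with h1 | ⟨h1, h1'⟩ <;> rcases h2 with h2 | ⟨h2, h2'⟩
    · exact Or.inl (h1.trans h2)
    · exact Or.inl (h2 ▸ h1)
    · exact Or.inl (h1 ▸ h2)
    · exact Or.inr ⟨h1.trans h2, List.lt_trans h1' h2'⟩

theorem MagnusVanishes.mono {w : FreeGroup α} {u t : List α} (h : MagnusVanishes w u)
    (ht : List.Shortlex (· < ·) t u) : MagnusVanishes w t := fun s hs hst =>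
  h s hs (_root_.trans hst ht)

theorem MagnusVanishes.coeff_mul_left {w : FreeGroup α} {u : List α} (h : MagnusVanishes w u)
    (w' : FreeGroup α) (hu : u ≠ []) :
    magnusCoeff (w * w') u = magnusCoeff w u + magnusCoeff w' u := by
  refine magnusCoeff_mul_of_forall w w' hu fun s t hs ht hst => Or.inl (h.of_length_lt hs ?_)
  subst hst
  simpa [List.length_pos_iff] using ht

theorem MagnusVanishes.coeff_mul_right {w : FreeGroup α} {u : List α} (h : MagnusVanishes w u)
    (w' : FreeGroup α) (hu : u ≠ []) :
    magnusCoeff (w' * w) u = magnusCoeff w' u + magnusCoeff w u := by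
  refine magnusCoeff_mul_of_forall w' w hu fun s t hs ht hst => Or.inr (h.of_length_lt ht ?_)
  subst hst
  simpa [List.length_pos_iff] using hs

theorem MagnusVanishes.mul {w w' : FreeGroup α} {u : List α} (h : MagnusVanishes w u)
    (h' : MagnusVanishes w' u) : MagnusVanishes (w * w') u := fun t ht htu => by
  rw [(h.mono htu).coeff_mul_left _ ht, h t ht htu, h' t ht htu, add_zero]

/-- The set of elements of the free group whose Magnus expansion has positive leading
coefficient. -/
def magnusCone (α : Type*) [LinearOrder α] : Set (FreeGroup α) :=
  {w | ∃ u, u ≠ [] ∧ 0 < magnusCoeff w u ∧ MagnusVanishes w u}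

variable [WellFoundedLT α]

theorem MagnusVanishes.of_mul_eq {w w' v : FreeGroup α} {u : List α} (h : MagnusVanishes w u)
    (hv : w' * v = v * w ∨ w' * w = 1 ∧ v = w) : MagnusVanishes w' u := by
  have hwf := List.Shortlex.wf (wellFounded_lt (α := α))
  intro t
  induction t using hwf.induction with
  | _ t ih =>
  intro ht htu
  have hw' : MagnusVanishes w' t := fun s hs hst => ih s hst hs (_root_.trans hst htu)
  rcases hv with hv | ⟨hv, -⟩
  · have h1 := hw'.coeff_mul_left v ht
    rw [hv, (h.mono htu).coeff_mul_right v ht, h t ht htu] at h1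
    omega
  · have h1 := hw'.coeff_mul_left w ht
    rw [hv, h t ht htu, magnusCoeff_one, if_neg ht] at h1
    omega

theorem isBiPosCone_magnusCone : IsBiPosCone (magnusCone α) := by
  have hwf := List.Shortlex.wf (wellFounded_lt (α := α))
  have hone : (1 : FreeGroup α) ∉ magnusCone α := by
    rintro ⟨u, hu, h0, -⟩
    simp [magnusCoeff_one, hu] at h0
  have hmul : ∀ a ∈ magnusCone α, ∀ b ∈ magnusCone α, a * b ∈ magnusCone α := by
    rintro a ⟨u, hu, hau, hva⟩ b ⟨t, ht, hbt, hvb⟩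
    rcases trichotomous_of (List.Shortlex (· < ·)) u t with h | rfl | h
    · refine ⟨u, hu, ?_, hva.mul (hvb.mono h)⟩
      rwa [hva.coeff_mul_left _ hu, hvb u hu h, add_zero]
    · refine ⟨u, hu, ?_, hva.mul hvb⟩
      rw [hva.coeff_mul_left _ hu]
      exact add_pos hau hbt
    · refine ⟨t, ht, ?_, (hva.mono h).mul hvb⟩
      rwa [hvb.coeff_mul_right _ ht, hva t ht h, zero_add]
  have hinv : ∀ g : FreeGroup α, g ≠ 1 → g ∈ magnusCone α ∨ g⁻¹ ∈ magnusCone α := by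
    intro g hg
    obtain ⟨u, ⟨hu, hgu⟩, hmin⟩ := hwf.has_min {u | u ≠ [] ∧ magnusCoeff g u ≠ 0}
      (exists_magnusCoeff_ne_zero_of_ne_one hg)
    have hv : MagnusVanishes g u := fun t ht htu => by
      by_contra h
      exact hmin t ⟨ht, h⟩ htu
    rcases hgu.lt_or_gt with h | h
    · right
      refine ⟨u, hu, ?_, hv.of_mul_eq (v := g) (Or.inr ⟨inv_mul_cancel g, rfl⟩)⟩
      have h1 := hv.coeff_mul_left g⁻¹ hu
      rw [mul_inv_cancel, magnusCoeff_one, if_neg hu] at h1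
      omega
    · exact Or.inl ⟨u, hu, h, hv⟩
  refine ⟨⟨hmul, fun g => ?_⟩, ?_⟩
  · by_cases hg : g = 1
    · subst hg
      simp [hone]
    · have hnot : ¬(g ∈ magnusCone α ∧ g⁻¹ ∈ magnusCone α) := fun h =>
        hone (by simpa using hmul _ h.1 _ h.2)
      have := hinv g hg
      tauto
  · rintro g p ⟨u, hu, hpu, hvp⟩
    have hv : MagnusVanishes (g * p * g⁻¹) u := hvp.of_mul_eq (v := g) (Or.inl (by group))
    refine ⟨u, hu, ?_, hv⟩
    have h1 := hv.coeff_mul_left g hu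
    rw [inv_mul_cancel_right, hvp.coeff_mul_right g hu] at h1
    omega

end MagnusCone

theorem exists_pow_le_lt_pow {G : Type*} [Monoid G] [LinearOrder G] [MulLeftStrictMono G]
    {a b : G} (ht : 1 ≤ a) (hb : 1 < b) (h : ∃ n : ℕ, a ≤ b ^ n) :
    ∃ m : ℕ, b ^ m ≤ a ∧ a < b ^ (m + 1) := by
  have h' : ∃ n : ℕ, a < b ^ n := by
    obtain ⟨n, hn⟩ := h
    exact ⟨n + 1, hn.trans_lt (pow_lt_pow_right' hb n.lt_succ_self)⟩
  classical
  obtain ⟨m, hm⟩ : ∃ m, Nat.find h' = m + 1 := Nat.exists_eq_succ_of_ne_zero fun h0 => by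
    have := Nat.find_spec h'
    rw [h0, pow_zero] at this
    exact ht.not_gt this
  refine ⟨m, not_lt.1 (Nat.find_min h' (by omega)), ?_⟩
  rw [← hm]
  exact Nat.find_spec h'

section PowBelow

variable {G : Type*} [Group G] [LinearOrder G] [MulLeftMono G] [MulRightMono G] {w v a b f g : G}

/-- The elements all of whose positive powers stay below `w`. -/
def powBelow (w : G) : LowerSet G where
  carrier := {g | ∀ n : ℕ, g ^ n < w}
  lower' _ _ hba ha n := (pow_le_pow_left' hba n).trans_lt (ha n)

theorem mem_powBelow_iff : g ∈ powBelow w ↔ ∀ n : ℕ, g ^ n < w := Iff.rfl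

theorem powBelow_mono (h : w ≤ v) : powBelow w ≤ powBelow v := fun _ hg n => (hg n).trans_le h

theorem notMem_powBelow_self : w ∉ powBelow w := fun h => by simpa using h 1

theorem mem_powBelow_of_le_one (hw : 1 < w) (hg : g ≤ 1) : g ∈ powBelow w := fun n =>
  (pow_le_one' hg n).trans_lt hw

theorem mul_mem_powBelow (ha : a ∈ powBelow w) (hb : b ∈ powBelow w) : a * b ∈ powBelow w := by
  have hm : a ⊔ b ∈ powBelow w := by
    rcases max_choice a b with h | h <;> rwa [h]
  intro n
  refine lt_of_le_of_lt (pow_le_pow_left' (mul_le_mul' (le_max_left a b) (le_max_right a b)) n) ?_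
  rw [← pow_two, ← pow_mul]
  exact hm _

theorem conj_mem_powBelow_iff : f * g * f⁻¹ ∈ powBelow (f * w * f⁻¹) ↔ g ∈ powBelow w := by
  simp only [mem_powBelow_iff, conj_pow, mul_lt_mul_iff_right, mul_lt_mul_iff_left]

theorem mem_powBelow_conj_iff : g ∈ powBelow (f * w * f⁻¹) ↔ f⁻¹ * g * f ∈ powBelow w := by
  rw [← conj_mem_powBelow_iff (f := f) (g := f⁻¹ * g * f)]
  simp [mul_assoc]

theorem powBelow_le_of_notMem (h : v ∉ powBelow w) : powBelow w ≤ powBelow v := by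
  intro g hg n
  by_contra! hn
  refine h fun m => (pow_le_pow_left' hn m).trans_lt ?_
  rw [← pow_mul]
  exact hg _

theorem powBelow_conj_le (h : powBelow w ≤ powBelow v) (f : G) :
    powBelow (f * w * f⁻¹) ≤ powBelow (f * v * f⁻¹) := fun g hg => by
  have hg' : g ∈ powBelow (f * w * f⁻¹) := hg
  rw [mem_powBelow_conj_iff] at hg'
  have : f⁻¹ * g * f ∈ powBelow v := h hg'
  rwa [← mem_powBelow_conj_iff] at this

theorem powBelow_conj_lt (h : powBelow w < powBelow v) (f : G) :
    powBelow (f * w * f⁻¹) < powBelow (f * v * f⁻¹) := by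
  refine lt_of_le_not_ge (powBelow_conj_le h.le f) fun hle => h.not_ge ?_
  simpa [mul_assoc] using powBelow_conj_le hle f⁻¹

theorem one_lt_conj_iff : 1 < f * g * f⁻¹ ↔ 1 < g := by
  rw [← mul_lt_mul_iff_right f, inv_mul_cancel_right, one_mul, lt_mul_iff_one_lt_right']

/-- The largest convex subgroup that does not contain `w`. -/
def convexBelow (hw : 1 < w) : Subgroup G where
  carrier := {g | g ∈ powBelow w ∧ g⁻¹ ∈ powBelow w}
  one_mem' := by simpa using mem_powBelow_of_le_one hw le_rfl
  mul_mem' := fun ha hb => ⟨mul_mem_powBelow ha.1 hb.1, by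
    rw [mul_inv_rev]
    exact mul_mem_powBelow hb.2 ha.2⟩
  inv_mem' := fun h => ⟨h.2, by simpa using h.1⟩

theorem mem_convexBelow_iff (hw : 1 < w) :
    g ∈ convexBelow hw ↔ g ∈ powBelow w ∧ g⁻¹ ∈ powBelow w := Iff.rfl

theorem mem_convexBelow_iff_of_one_le (hw : 1 < w) (hg : 1 ≤ g) :
    g ∈ convexBelow hw ↔ g ∈ powBelow w :=
  ⟨And.left, fun h => ⟨h, mem_powBelow_of_le_one hw (inv_le_one'.2 hg)⟩⟩

theorem powBelow_conj_of_mem (hw : 1 < w) (hf : f ∈ convexBelow hw) :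
    powBelow (f * w * f⁻¹) = powBelow w := by
  have h : ∀ {f}, f ∈ convexBelow hw → powBelow (f * w * f⁻¹) ≤ powBelow w := fun {f} hf g hg => by
    have hg' : g ∈ powBelow (f * w * f⁻¹) := hg
    rw [mem_powBelow_conj_iff] at hg'
    have := mul_mem_powBelow (mul_mem_powBelow hf.1 hg') hf.2
    simpa [mul_assoc] using this
  refine (h hf).antisymm ?_
  simpa [mul_assoc] using powBelow_conj_le (h (inv_mem hf)) f

theorem mul_comm_le_of_forall_le_pow (ha : 1 < a) (hb : 1 < b)
    (hpa : ∀ c, 1 < c → ∃ n : ℕ, a ≤ c ^ n) (hpb : ∀ c, 1 < c → ∃ n : ℕ, b ≤ c ^ n) :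
    a * b ≤ b * a := by
  by_contra! hlt
  have he : 1 < a * b * (b * a)⁻¹ := lt_mul_inv_iff_mul_lt.2 (by rwa [one_mul])
  set e := a * b * (b * a)⁻¹ with hedef
  by_cases hc : ∃ c, 1 < c ∧ c < e
  · obtain ⟨d, hd, hde⟩ : ∃ d, 1 < d ∧ d * d ≤ e := by
      obtain ⟨c, hc, hce⟩ := hc
      rcases le_or_gt (c * c) e with h | h
      · exact ⟨c, hc, h⟩
      · refine ⟨c⁻¹ * e, lt_inv_mul_iff_mul_lt.2 (by rwa [mul_one]), ?_⟩
        rw [← mul_assoc]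
        refine mul_le_of_le_one_left' ?_
        rw [mul_assoc, inv_mul_le_one_iff, mul_inv_le_iff_le_mul]
        exact h.le
    obtain ⟨m, hm, hm'⟩ := exists_pow_le_lt_pow ha.le hd (hpa d hd)
    obtain ⟨k, hk, hk'⟩ := exists_pow_le_lt_pow hb.le hd (hpb d hd)
    have h1 : a * b < d ^ (m + 1) * d ^ (k + 1) := mul_lt_mul_of_lt_of_lt hm' hk'
    have h2 : d ^ k * d ^ m ≤ b * a := mul_le_mul' hk hm
    have h3 : d * d * (d ^ k * d ^ m) ≤ e * (b * a) := mul_le_mul' hde h2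
    rw [hedef, inv_mul_cancel_right] at h3
    refine h3.not_gt (h1.trans_eq ?_)
    rw [← pow_two, ← pow_add, ← pow_add, ← pow_add]
    congr 1
    omega
  · push Not at hc
    have hpow : ∀ x, 1 < x → (∃ n : ℕ, x ≤ e ^ n) → ∃ n : ℕ, x = e ^ n := fun x hx hn => by
      obtain ⟨m, hm, hm'⟩ := exists_pow_le_lt_pow hx.le he hn
      refine ⟨m, hm.antisymm' ?_⟩
      by_contra! h
      have := hc _ (lt_inv_mul_iff_mul_lt.2 (by rwa [mul_one]))
      rw [le_inv_mul_iff_mul_le, ← pow_succ] at this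
      exact this.not_gt hm'
    obtain ⟨m, hm⟩ := hpow a ha (hpa _ he)
    obtain ⟨k, hk⟩ := hpow b hb (hpb _ he)
    clear_value e
    refine hlt.ne ?_
    rw [hm, hk, ← pow_add, ← pow_add, add_comm]

end PowBelow

section FreeGroup

variable {α : Type*}

theorem FreeGroup.mk_injective_of_length {L M : List (α × Bool)} (hL : FreeGroup.IsReduced L)
    (h : FreeGroup.mk L = FreeGroup.mk M) (hlen : M.length ≤ L.length) : L = M := by
  classical
  have hr : FreeGroup.reduce M = L := by
    rw [← hL.reduce_eq]
    exact (FreeGroup.reduce.sound h).symm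
  have hs : L.Sublist M := hr ▸ (FreeGroup.reduce.red (L := M)).sublist
  exact hs.eq_of_length (hs.length_le.antisymm hlen)

theorem FreeGroup.exists_not_commute_conj [Nontrivial α] {t : FreeGroup α} (ht : t ≠ 1) :
    ∃ b, t * (b * t * b⁻¹) ≠ b * t * b⁻¹ * t := by
  classical
  have hr := FreeGroup.isReduced_toWord (x := t)
  set L := t.toWord with hLdef
  have htL : t = FreeGroup.mk L := FreeGroup.mk_toWord.symm
  have hL : L ≠ [] := fun h => ht (FreeGroup.toWord_eq_nil_iff.1 h)
  obtain ⟨c, hc⟩ := exists_ne (L.head hL).1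
  obtain ⟨ε, hε⟩ : ∃ ε : Bool, (c, ε) ≠ L.getLast hL := by
    by_cases h : (c, true) = L.getLast hL
    · exact ⟨false, fun h' => by simpa using h.trans h'.symm⟩
    · exact ⟨true, h⟩
  have hlast : ∀ x ∈ L.getLast?, x.1 = c → x.2 = !ε := by
    intro x hx hxc
    rw [List.getLast?_eq_getLast_of_ne_nil hL, Option.mem_some] at hx
    have : x.2 ≠ ε := by
      rintro rfl
      rw [← hxc] at hε
      exact hε hx.symm
    exact Bool.eq_not_of_ne this
  refine ⟨FreeGroup.mk [(c, ε)], fun heq => ?_⟩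
  rw [htL, FreeGroup.inv_mk, FreeGroup.mul_mk, FreeGroup.mul_mk, FreeGroup.mul_mk,
    FreeGroup.mul_mk] at heq
  have hred : FreeGroup.IsReduced ([(c, ε)] ++ L ++ FreeGroup.invRev [(c, ε)] ++ L) := by
    have hhead : ∀ x ∈ L.head?, x.1 ≠ c := by
      intro x hx
      rw [List.head?_eq_some_head hL, Option.mem_some] at hx
      rw [← hx]
      exact hc.symm
    simp only [FreeGroup.invRev, FreeGroup.IsReduced, List.isChain_append]
    refine ⟨⟨⟨by simp, hr, ?_⟩, by simp, ?_⟩, hr, ?_⟩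
    · rintro x hx y hy h
      simp at hx
      subst hx
      exact absurd h.symm (hhead y hy)
    · rintro x hx y hy h
      simp at hy
      subst hy
      rw [List.getLast?_append_of_ne_nil _ hL] at hx
      exact hlast x hx h
    · rintro x hx y hy h
      have hx' : x = (c, !ε) := by
        have := List.getLast?_append_of_ne_nil ([(c, ε)] ++ L)
          (l₂ := (List.map (fun g : α × Bool => (g.1, !g.2)) [(c, ε)]).reverse) (by simp)
        rw [this] at hx
        simpa [eq_comm] using hx
      rw [hx'] at h
      exact absurd h.symm (hhead y hy)
  have := FreeGroup.mk_injective_of_length hred heq.symm (by simp; omega)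
  have h2 := congrArg List.head? this
  rw [List.head?_append_of_ne_nil _ hL] at h2
  rw [List.head?_eq_some_head hL] at h2
  simp at h2
  exact hc (by rw [← h2])

theorem exists_mem_powBelow [Nontrivial α] [LinearOrder (FreeGroup α)] [MulLeftMono (FreeGroup α)]
    [MulRightMono (FreeGroup α)] {t : FreeGroup α} (ht : 1 < t) :
    ∃ w, 1 < w ∧ w ∈ powBelow t := by
  by_contra! h
  have hpt : ∀ c, 1 < c → ∃ n : ℕ, t ≤ c ^ n := fun c hc => by
    simpa [mem_powBelow_iff] using h c hc
  obtain ⟨b, hb⟩ := FreeGroup.exists_not_commute_conj ht.ne'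
  have hpb : ∀ c, 1 < c → ∃ n : ℕ, b * t * b⁻¹ ≤ c ^ n := fun c hc => by
    obtain ⟨n, hn⟩ := hpt (b⁻¹ * c * b⁻¹⁻¹) (one_lt_conj_iff.2 hc)
    refine ⟨n, ?_⟩
    rw [conj_pow] at hn
    have := mul_le_mul_left (mul_le_mul_right hn b) b⁻¹
    simpa [mul_assoc] using this
  have ht' : 1 < b * t * b⁻¹ := one_lt_conj_iff.2 ht
  exact hb ((mul_comm_le_of_forall_le_pow ht ht' hpt hpb).antisymm
    (mul_comm_le_of_forall_le_pow ht' ht hpb hpt))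

end FreeGroup

section WreathSign

open RegularWreathProduct

variable {A Q : Type*} [CommGroup Q] [LinearOrder Q]

/-- The sign of an element of a wreath product over an ordered group, relative to a sign relation
on the bottom group: the sign of the top coordinate if that is nontrivial, and otherwise the
leading sign among the bottom coordinates. -/
def WreathSign (R : A → SignType → Prop) (W : A ≀ᵣ Q) (s : SignType) : Prop :=
  (1 < W.right ∧ s = 1) ∨ (W.right < 1 ∧ s = -1) ∨
    (W.right = 1 ∧ ∃ i, R (W.left i) s ∧ (∀ j, i < j → R (W.left j) 0) ∧
      (s = 0 → ∀ j, R (W.left j) 0))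

namespace WreathSign

variable {R R₁ R₂ R₃ : A → SignType → Prop} {W V : A ≀ᵣ Q} {s t : SignType}

theorem mono (h : ∀ a s, R₁ a s → R₂ a s) (hW : WreathSign R₁ W s) : WreathSign R₂ W s := by
  rcases hW with hW | hW | ⟨h1, i, hi, hj, h0⟩
  · exact Or.inl hW
  · exact Or.inr (Or.inl hW)
  · exact Or.inr (Or.inr ⟨h1, i, h _ _ hi, fun j hij => h _ _ (hj j hij),
      fun hs j => h _ _ (h0 hs j)⟩)

theorem unique (h : ∀ a s t, R₁ a s → R₂ a t → s = t) (hs : WreathSign R₁ W s)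
    (ht : WreathSign R₂ W t) : s = t := by
  rcases hs with ⟨h1, rfl⟩ | ⟨h1, rfl⟩ | ⟨h1, i, hi, hij, hi0⟩ <;>
    rcases ht with ⟨g1, rfl⟩ | ⟨g1, rfl⟩ | ⟨g1, j, hj, hji, hj0⟩
  · rfl
  · exact absurd (h1.trans g1) (lt_irrefl _)
  · exact absurd g1 h1.ne'
  · exact absurd (h1.trans g1) (lt_irrefl _)
  · rfl
  · exact absurd g1 h1.ne
  · exact absurd h1 g1.ne'
  · exact absurd h1 g1.ne
  · rcases lt_trichotomy i j with hlt | rfl | hlt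
    · have ht : t = 0 := (h _ _ _ (hij _ hlt) hj).symm
      exact h _ _ _ hi (ht ▸ hj0 ht i)
    · exact h _ _ _ hi hj
    · have hs : s = 0 := h _ _ _ hi (hji _ hlt)
      exact h _ _ _ (hs ▸ hi0 hs j) hj

variable [Group A]

theorem conj_base (u : Q → A) (h : ∀ i s, R₁ (W.left i) s → R₂ (u i * W.left i * (u i)⁻¹) s)
    (hW : WreathSign R₁ W s) :
    WreathSign R₂ ((⟨u, 1⟩ : A ≀ᵣ Q) * W * (⟨u, 1⟩ : A ≀ᵣ Q)⁻¹) s := by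
  rcases hW with hW | hW | ⟨h1, i, hi, hj, h0⟩
  · exact Or.inl (by simpa using hW)
  · exact Or.inr (Or.inl (by simpa using hW))
  · have key : ∀ i, ((⟨u, 1⟩ : A ≀ᵣ Q) * W * (⟨u, 1⟩ : A ≀ᵣ Q)⁻¹).left i =
        u i * W.left i * (u i)⁻¹ := fun i => by simp [h1]
    refine Or.inr (Or.inr ⟨by simp [h1], i, ?_, fun j hij => ?_, fun hs j => ?_⟩) <;> rw [key]
    · exact h _ _ hi
    · exact h _ _ (hj _ hij)
    · exact h _ _ (h0 hs j)

theorem conj_shift (q : Q) [IsOrderedMonoid Q] (hW : WreathSign R W s) :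
    WreathSign R ((⟨1, q⟩ : A ≀ᵣ Q) * W * (⟨1, q⟩ : A ≀ᵣ Q)⁻¹) s := by
  have hr : ((⟨1, q⟩ : A ≀ᵣ Q) * W * (⟨1, q⟩ : A ≀ᵣ Q)⁻¹).right = W.right := by
    simp [mul_comm q]
  have hl : ∀ i, ((⟨1, q⟩ : A ≀ᵣ Q) * W * (⟨1, q⟩ : A ≀ᵣ Q)⁻¹).left i = W.left (q⁻¹ * i) :=
    fun i => by simp [inv_left]
  rcases hW with hW | hW | ⟨h1, i, hi, hj, h0⟩
  · exact Or.inl (by rwa [hr])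
  · exact Or.inr (Or.inl (by rwa [hr]))
  · refine Or.inr (Or.inr ⟨by rwa [hr], q * i, ?_, fun j hij => ?_, fun hs j => ?_⟩) <;> rw [hl]
    · simpa using hi
    · exact hj _ (lt_inv_mul_iff_mul_lt.2 hij)
    · exact h0 hs _

theorem inv [IsOrderedMonoid Q] (h : ∀ a s, R₁ a s → R₂ a⁻¹ (-s)) (hW : WreathSign R₁ W s) :
    WreathSign R₂ W⁻¹ (-s) := by
  rcases hW with ⟨h1, rfl⟩ | ⟨h1, rfl⟩ | ⟨h1, i, hi, hj, h0⟩
  · exact Or.inr (Or.inl (by simpa using h1))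
  · exact Or.inl (by simpa using h1)
  · have hl : ∀ i, W⁻¹.left i = (W.left i)⁻¹ := fun i => by simp [h1]
    refine Or.inr (Or.inr ⟨by simp [h1], i, ?_, fun j hij => ?_, fun hs j => ?_⟩) <;> rw [hl]
    · exact h _ _ hi
    · exact h _ _ (hj _ hij)
    · exact h _ _ (h0 (by simpa using hs) j)

theorem mul [IsOrderedMonoid Q]
    (h : ∀ a b s t, 0 ≤ s → 0 ≤ t → R₁ a s → R₂ b t → R₃ (a * b) (max s t))
    (hW : WreathSign R₁ W s) (hV : WreathSign R₂ V t) (hs : 0 ≤ s) (ht : 0 ≤ t) :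
    WreathSign R₃ (W * V) (max s t) := by
  rcases hW with ⟨h1, rfl⟩ | ⟨h1, rfl⟩ | ⟨h1, i, hi, hij, hi0⟩
  · have : 1 < (W * V).right := by
      rcases hV with ⟨g1, -⟩ | ⟨g1, rfl⟩ | ⟨g1, -⟩
      · exact one_lt_mul' h1 g1
      · exact absurd ht (by decide)
      · simpa [g1] using h1
    exact Or.inl ⟨this, max_eq_left (SignType.le_one t)⟩
  · exact absurd hs (by decide)
  rcases hV with ⟨g1, rfl⟩ | ⟨g1, rfl⟩ | ⟨g1, j, hj, hji, hj0⟩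
  · exact Or.inl ⟨by simpa [h1] using g1, max_eq_right (SignType.le_one s)⟩
  · exact absurd ht (by decide)
  have hl : ∀ i, (W * V).left i = W.left i * V.left i := fun i => by simp [h1]
  have h00 : max (0 : SignType) 0 = 0 := rfl
  rcases eq_or_ne t 0 with rfl | ht0
  · refine Or.inr (Or.inr ⟨by simp [h1, g1], i, ?_, fun k hk => ?_, fun h0 k => ?_⟩) <;> rw [hl]
    · exact h _ _ _ _ hs ht hi (hj0 rfl i)
    · exact h _ _ _ _ le_rfl le_rfl (hij k hk) (hj0 rfl k)
    · have : s = 0 := by rwa [max_eq_left hs] at h0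
      exact h _ _ _ _ le_rfl le_rfl (hi0 this k) (hj0 rfl k)
  rcases eq_or_ne s 0 with rfl | hs0
  · refine Or.inr (Or.inr ⟨by simp [h1, g1], j, ?_, fun k hk => ?_, fun h0 k => ?_⟩) <;> rw [hl]
    · exact h _ _ _ _ hs ht (hi0 rfl j) hj
    · exact h _ _ _ _ le_rfl le_rfl (hi0 rfl k) (hji k hk)
    · exact absurd (by rwa [max_eq_right ht] at h0) ht0
  have hpos : ∀ u : SignType, 0 ≤ u → u ≠ 0 → u = 1 := by decide
  have hs1 : s = 1 := hpos s hs hs0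
  have ht1 : t = 1 := hpos t ht ht0
  subst hs1 ht1
  refine Or.inr (Or.inr ⟨by simp [h1, g1], max i j, ?_, fun k hk => ?_, fun h0 => ?_⟩)
  · rw [hl]
    rcases lt_trichotomy i j with hlt | rfl | hlt
    · rw [max_eq_right hlt.le]
      exact h _ _ 0 1 le_rfl ht (hij _ hlt) hj
    · rw [max_self]
      exact h _ _ _ _ hs ht hi hj
    · rw [max_eq_left hlt.le]
      exact h _ _ 1 0 hs le_rfl hi (hji _ hlt)
  · rw [hl]
    obtain ⟨hk1, hk2⟩ := max_lt_iff.1 hk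
    exact h _ _ _ _ le_rfl le_rfl (hij _ hk1) (hji _ hk2)
  · exact absurd h0 (by decide)

end WreathSign

namespace RegularWreathProduct

variable {A Q : Type*} [Group A] [Group Q]

/-- The inclusion of the base group of a regular wreath product. -/
def baseHom : (Q → A) →* A ≀ᵣ Q where
  toFun u := ⟨u, 1⟩
  map_one' := rfl
  map_mul' u v := by ext <;> simp

@[simp] theorem baseHom_left (u : Q → A) : (baseHom u).left = u := rfl

@[simp] theorem baseHom_right (u : Q → A) : (baseHom u).right = 1 := rfl

open Classical in
/-- The inclusion of the bottom group as the coordinate at `1`. -/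
noncomputable def single : A →* A ≀ᵣ Q :=
  baseHom.comp (MonoidHom.mulSingle (fun _ : Q => A) 1)

open Classical in
theorem single_def (a : A) : single a = baseHom (Pi.mulSingle (1 : Q) a) := rfl

@[simp] theorem single_right (a : A) : (single a : A ≀ᵣ Q).right = 1 := rfl

@[simp] theorem single_left_one (a : A) : (single a : A ≀ᵣ Q).left 1 = a := by
  simp [single_def]

theorem single_left_ne (a : A) {q : Q} (h : q ≠ 1) : (single a : A ≀ᵣ Q).left q = 1 := by
  classical
  simp [single_def, Pi.mulSingle_eq_of_ne h]

end RegularWreathProduct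

namespace WreathSign

variable {A Q : Type*} [CommGroup Q] [LinearOrder Q] [Group A]
  {R R₁ R₂ : A → SignType → Prop} {a : A} {s : SignType}

theorem single (h1 : R 1 0) (h : R a s) : WreathSign R (single a : A ≀ᵣ Q) s := by
  refine Or.inr (Or.inr ⟨rfl, 1, by simpa using h, fun j hj => ?_, fun hs j => ?_⟩)
  · rwa [single_left_ne _ hj.ne']
  · by_cases hj : j = 1
    · subst hj
      simpa using hs ▸ h
    · rwa [single_left_ne _ hj]

theorem of_single (h1 : ∀ s, R 1 s → s = 0)
    (h : WreathSign R (RegularWreathProduct.single a : A ≀ᵣ Q) s) :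
    R a s := by
  rcases h with ⟨h, -⟩ | ⟨h, -⟩ | ⟨-, i, hi, -, h0⟩
  · exact absurd h (lt_irrefl _)
  · exact absurd h (lt_irrefl _)
  · by_cases hi1 : i = 1
    · subst hi1
      simpa using hi
    · have hs : s = 0 := h1 _ (by rwa [single_left_ne _ hi1] at hi)
      have := h0 hs 1
      rw [single_left_one] at this
      rwa [hs]

theorem exists_of_finite {R : ℕ → A → SignType → Prop}
    (hR : ∀ m n a s, m ≤ n → R m a s → R n a s) (h1 : R 1 1 0) (W : A ≀ᵣ Q)
    (hfin : {i | W.left i ≠ 1}.Finite) (h : ∀ i, ∃ n s, R n (W.left i) s) :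
    ∃ n s, WreathSign (R n) W s := by
  rcases lt_trichotomy W.right 1 with hlt | heq | hlt
  · exact ⟨0, -1, Or.inr (Or.inl ⟨hlt, rfl⟩)⟩
  swap
  · exact ⟨0, 1, Or.inl ⟨hlt, rfl⟩⟩
  have h' : ∀ i, ∃ n s, R n (W.left i) s ∧ (W.left i = 1 → n = 1 ∧ s = 0) := by
    intro i
    by_cases hi : W.left i = 1
    · exact ⟨1, 0, by rwa [hi], fun _ => ⟨rfl, rfl⟩⟩
    · obtain ⟨n, s, hn⟩ := h i
      exact ⟨n, s, hn, fun h => absurd h hi⟩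
  choose n s hn hs using h'
  obtain ⟨N, hN⟩ : ∃ N, ∀ i, n i ≤ N := by
    obtain ⟨N, hN⟩ := (hfin.image n).bddAbove
    refine ⟨max N 1, fun i => ?_⟩
    by_cases hi : W.left i = 1
    · exact (hs i hi).1.le.trans (le_max_right _ _)
    · exact (hN (Set.mem_image_of_mem n hi)).trans (le_max_left _ _)
  have hR' : ∀ i, R N (W.left i) (s i) := fun i => hR _ _ _ _ (hN i) (hn i)
  have hfin' : {i | s i ≠ 0}.Finite := hfin.subset fun i hi hW => hi (hs i hW).2
  by_cases hne : {i | s i ≠ 0}.Nonempty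
  · obtain ⟨i, hi, hmax⟩ := Set.exists_max_image _ id hfin' hne
    refine ⟨N, s i, Or.inr (Or.inr ⟨heq, i, hR' i, fun j hj => ?_, fun h0 => absurd h0 hi⟩)⟩
    have : s j = 0 := by
      by_contra hj0
      exact absurd (hmax j hj0) (not_le.2 hj)
    exact this ▸ hR' j
  · have : ∀ i, s i = 0 := fun i => by
      by_contra hi
      exact hne ⟨i, hi⟩
    exact ⟨N, 0, Or.inr (Or.inr ⟨heq, 1, this 1 ▸ hR' 1, fun j _ => this j ▸ hR' j,
      fun _ j => this j ▸ hR' j⟩)⟩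

end WreathSign

end WreathSign

section ConeSign

variable {G : Type*} [Group G] {P : Set G}

open Classical in
/-- The sign of a group element with respect to a positive cone. -/
noncomputable def coneSign (P : Set G) (g : G) : SignType :=
  if g ∈ P then 1 else if g = 1 then 0 else -1

theorem IsPosCone.one_notMem (hP : IsPosCone P) : (1 : G) ∉ P := by
  rcases hP.2 1 with h | h | h
  · exact h.2.1
  · exact absurd rfl h.2.1
  · exact absurd rfl h.2.1

theorem IsPosCone.inv_notMem (hP : IsPosCone P) {g : G} (hg : g ∈ P) : g⁻¹ ∉ P := by
  have := hP.2 g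
  tauto

theorem IsPosCone.inv_mem (hP : IsPosCone P) {g : G} (hg : g ∉ P) (h1 : g ≠ 1) : g⁻¹ ∈ P := by
  have := hP.2 g
  tauto

theorem IsPosCone.ne_one (hP : IsPosCone P) {g : G} (hg : g ∈ P) : g ≠ 1 := by
  rintro rfl
  exact hP.one_notMem hg

theorem IsBiPosCone.conj_mem_iff (hP : IsBiPosCone P) (a : G) {g : G} :
    a * g * a⁻¹ ∈ P ↔ g ∈ P := by
  refine ⟨fun h => ?_, hP.2 a g⟩
  have := hP.2 a⁻¹ _ h
  simpa [mul_assoc] using this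

theorem coneSign_one (hP : IsPosCone P) : coneSign P 1 = 0 := by
  simp [coneSign, hP.one_notMem]

theorem coneSign_eq_one_iff {g : G} : coneSign P g = 1 ↔ g ∈ P := by
  unfold coneSign
  split_ifs <;> simp_all

theorem coneSign_nonneg_iff {g : G} : 0 ≤ coneSign P g ↔ g = 1 ∨ g ∈ P := by
  unfold coneSign
  split_ifs with h1 h2
  · simp [h1]
  · simp [h2]
  · simp only [h1, h2, or_self, iff_false]
    decide

theorem coneSign_inv (hP : IsPosCone P) (g : G) : coneSign P g⁻¹ = -coneSign P g := by
  have := hP.2 g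
  unfold coneSign
  rcases this with ⟨rfl, h2, h3⟩ | ⟨h1, h2, h3⟩ | ⟨h1, h2, h3⟩
  · simp_all
  · simp [h1, h2, h3]
  · simp [h1, h2, h3]

theorem coneSign_conj (hP : IsBiPosCone P) (a g : G) : coneSign P (a * g * a⁻¹) = coneSign P g := by
  classical
  unfold coneSign
  convert if_congr (hP.conj_mem_iff a) rfl (if_congr (conj_eq_one_iff (a := a) (b := g)) rfl rfl)

end ConeSign

open RegularWreathProduct

/-- A group acting on the letters of the free group on itself by left translation. -/
def letterShift (G : Type*) [Group G] : G →* MulAut (FreeGroup G) where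
  toFun g := freeGroupCongr (Equiv.mulLeft g)
  map_one' := by
    refine MulEquiv.toMonoidHom_injective (FreeGroup.ext_hom _ _ fun h => ?_)
    simp
  map_mul' a b := by
    refine MulEquiv.toMonoidHom_injective (FreeGroup.ext_hom _ _ fun h => ?_)
    simp [mul_assoc]

@[simp] theorem letterShift_of {G : Type*} [Group G] (g h : G) :
    letterShift G g (of h) = of (g * h) := by
  simp [letterShift]

/-- The free product of `G` with an infinite cyclic group, presented as the semidirect product of
`G` with the free group on the conjugates, indexed by `G`, of the new generator. -/
abbrev FreeExtension (G : Type*) [Group G] := FreeGroup G ⋊[letterShift G] G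

/-- The subgroup of the free group on the letters in `S`. -/
def letterSpan {G : Type*} (S : Set G) : Subgroup (FreeGroup G) := Subgroup.closure (of '' S)

theorem letterSpan_mono {G : Type*} {S T : Set G} (h : S ⊆ T) : letterSpan S ≤ letterSpan T :=
  Subgroup.closure_mono (Set.image_mono h)

theorem of_mem_letterSpan {G : Type*} {S : Set G} {h : G} (hS : h ∈ S) : of h ∈ letterSpan S :=
  Subgroup.subset_closure (Set.mem_image_of_mem _ hS)

theorem letterShift_mem_letterSpan {G : Type*} [Group G] {S T : Set G} {g : G} {k : FreeGroup G}
    (h : ∀ s ∈ S, g * s ∈ T) (hk : k ∈ letterSpan S) : letterShift G g k ∈ letterSpan T := by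
  have : letterSpan S ≤ (letterSpan T).comap (letterShift G g).toMonoidHom := by
    refine (Subgroup.closure_le _).2 ?_
    rintro _ ⟨s, hs, rfl⟩
    simpa using of_mem_letterSpan (h s hs)
  exact this hk

theorem mem_letterSpan_of_forall {G : Type*} {S : Set G} (L : List (G × Bool))
    (h : ∀ a ∈ L, a.1 ∈ S) : FreeGroup.mk L ∈ letterSpan S := by
  induction L with
  | nil => exact one_mem _
  | cons a L ih =>
    rw [← List.singleton_append, ← FreeGroup.mul_mk]
    refine mul_mem ?_ (ih fun b hb => h b (List.mem_cons_of_mem _ hb))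
    obtain ⟨g, ε⟩ := a
    have := of_mem_letterSpan (h (g, ε) List.mem_cons_self)
    cases ε
    · exact inv_mem this
    · exact this

/-- A bi-ordered group acting on a linear order by order automorphisms, together with the data that
let the order be extended to a free extension: the point stabilizers form an increasing family of
convex subgroups, recorded through their effect on the cone. -/
structure ConvexAction (G Ω : Type*) [Group G] [LinearOrder Ω] [MulAction G Ω] where
  /-- The positive cone. -/
  P : Set G
  isBiPosCone : IsBiPosCone P
  /-- The base point. -/
  pt : Ω
  smul_le : ∀ (a : G) {x y : Ω}, x ≤ y → a • x ≤ a • y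
  fixed_mono : ∀ {f : G} {x y : Ω}, x ≤ y → f • x = x → f • y = y
  mul_moves : ∀ {f g : G} {x : Ω}, f ∈ P → g ∈ P → f • x ≠ x →
    (f * g) • x ≠ x ∧ (g * f) • x ≠ x
  mul_mem_cone : ∀ {f g : G} {x : Ω}, f ∈ P → f • x ≠ x → g • x = x → f * g ∈ P ∧ g * f ∈ P

namespace ConvexAction

variable {G Ω : Type*} [Group G] [LinearOrder Ω] [MulAction G Ω] (E : ConvexAction G Ω)

/-- The wreath product receiving the local data of the free extension at a point. -/
abbrev Local (G : Type*) [Group G] := FreeExtension G ≀ᵣ Multiplicative ℤ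

/-- The generator of the top group. -/
def shift (G : Type*) [Group G] : Local G := ⟨1, Multiplicative.ofAdd 1⟩

open Classical in
/-- The image of a letter in the wreath product at the point `x`. -/
noncomputable def letterImage (x : Ω) (h : G) : Local G :=
  if h • E.pt = x then
    single (SemidirectProduct.inr h) * shift G * (single (SemidirectProduct.inr h))⁻¹
  else single (SemidirectProduct.inl (of h))

/-- The homomorphism to the wreath product at `x` which counts the letters at `x`. -/
noncomputable def letterHom (x : Ω) : FreeGroup G →* Local G := FreeGroup.lift (E.letterImage x)

/-- The local data at `x` of an element of the free extension. -/
noncomputable def localize (x : Ω) (W : FreeExtension G) : Local G :=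
  E.letterHom x W.left * single (SemidirectProduct.inr W.right)

theorem letterHom_letterShift (x : Ω) (a : G) (k : FreeGroup G) :
    E.letterHom (a • x) (letterShift G a k) =
      single (SemidirectProduct.inr a) * E.letterHom x k *
        (single (SemidirectProduct.inr a))⁻¹ := by
  have : (E.letterHom (a • x)).comp (letterShift G a).toMonoidHom =
      (MulAut.conj (single (SemidirectProduct.inr a) : Local G)).toMonoidHom.comp
        (E.letterHom x) := by
    refine FreeGroup.ext_hom _ _ fun h => ?_
    have hiff : (a * h) • E.pt = a • x ↔ h • E.pt = x := by
      rw [mul_smul, smul_left_cancel_iff]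
    simp only [MonoidHom.comp_apply, MulEquiv.coe_toMonoidHom, letterShift_of, MulAut.conj_apply,
      letterHom, FreeGroup.lift_apply_of, letterImage, hiff]
    split_ifs with hx
    · simp only [map_mul]
      group
    · rw [← letterShift_of, SemidirectProduct.inl_aut, map_mul, map_mul, map_inv, map_inv]
  exact DFunLike.congr_fun this k

theorem localize_conj (x : Ω) (a : G) (W : FreeExtension G) :
    E.localize (a • x) (SemidirectProduct.inr a * W * (SemidirectProduct.inr a)⁻¹) =
      single (SemidirectProduct.inr a) * E.localize x W *
        (single (SemidirectProduct.inr a))⁻¹ := by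
  have hl : (SemidirectProduct.inr a * W * (SemidirectProduct.inr a)⁻¹).left =
      letterShift G a W.left := by simp
  have hr : (SemidirectProduct.inr a * W * (SemidirectProduct.inr a)⁻¹).right =
      a * W.right * a⁻¹ := by simp
  rw [localize, hl, hr, letterHom_letterShift, localize]
  simp only [map_mul, map_inv]
  group

theorem localize_mul {x : Ω} {W : FreeExtension G} (hW : W.right • x = x) (V : FreeExtension G) :
    E.localize x (W * V) = E.localize x W * E.localize x V := by
  have := E.letterHom_letterShift x W.right V.left
  rw [hW] at this
  rw [localize, SemidirectProduct.mul_left, map_mul, this, SemidirectProduct.mul_right, map_mul,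
    map_mul, localize, localize]
  group

theorem localize_one (x : Ω) : E.localize x 1 = 1 := by simp [localize]

theorem localize_inv {x : Ω} {W : FreeExtension G} (hW : W.right • x = x) :
    E.localize x W⁻¹ = (E.localize x W)⁻¹ := by
  rw [eq_inv_iff_mul_eq_one, ← E.localize_mul, inv_mul_cancel, localize_one]
  simpa [inv_smul_eq_iff] using hW.symm

/-- Elements over the stabilizer of `x` all of whose letters lie weakly below `x`. -/
def below (x : Ω) : Subgroup (FreeExtension G) where
  carrier := {W | W.right • x = x ∧ W.left ∈ letterSpan {h | h • E.pt ≤ x}}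
  one_mem' := ⟨by simp, one_mem _⟩
  mul_mem' := by
    rintro W V ⟨h1, h2⟩ ⟨g1, g2⟩
    refine ⟨by simp [mul_smul, h1, g1], mul_mem h2 (letterShift_mem_letterSpan ?_ g2)⟩
    intro s hs
    simpa [mul_smul, h1] using E.smul_le W.right hs
  inv_mem' := by
    rintro W ⟨h1, h2⟩
    have h1' : W.right⁻¹ • x = x := inv_smul_eq_iff.2 h1.symm
    refine ⟨h1', letterShift_mem_letterSpan ?_ (inv_mem h2)⟩
    intro s hs
    simpa [mul_smul, h1'] using E.smul_le W.right⁻¹ hs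

theorem localize_of_lt {x : Ω} {W : FreeExtension G}
    (hW : W.left ∈ letterSpan {h | h • E.pt < x}) : E.localize x W = single W := by
  have hle : letterSpan {h | h • E.pt < x} ≤
      (E.letterHom x).eqLocus ((single (Q := Multiplicative ℤ)).comp SemidirectProduct.inl) := by
    refine (Subgroup.closure_le _).2 ?_
    rintro _ ⟨s, hs, rfl⟩
    have : s • E.pt ≠ x := ne_of_lt hs
    change E.letterHom x (of s) = single (SemidirectProduct.inl (of s))
    simp [letterHom, letterImage, this]
  have h : E.letterHom x W.left = single (SemidirectProduct.inl W.left) := hle hW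
  rw [localize, h, ← map_mul, SemidirectProduct.inl_left_mul_inr_right]

/-- The letters moved by a group element. -/
def moved (f : G) : Set G := {h | f • h • E.pt ≠ h • E.pt}

/-- `E.ExtSign n W s` says that the order on the free extension gives `W` the sign `s`, as
witnessed by a computation of depth at most `n`. -/
def ExtSign : ℕ → FreeExtension G → SignType → Prop
  | 0, _, _ => False
  | n + 1, W, s => (W.left ∈ letterSpan (E.moved W.right) ∧ s = coneSign E.P W.right) ∨
      ∃ x, W ∈ E.below x ∧ WreathSign (ExtSign n) (E.localize x W) s

end ConvexAction

namespace ConvexAction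
variable {G Ω : Type*} [Group G] [LinearOrder Ω] [MulAction G Ω] {E : ConvexAction G Ω}

theorem moved_subset {f : G} {x : Ω} (hf : f • x = x) : E.moved f ⊆ {h | h • E.pt < x} :=
  fun _ hh => not_le.1 fun hle => hh (E.fixed_mono hle hf)

theorem left_mem_of_below_of_lt {x y : Ω} {W : FreeExtension G} (hW : W ∈ E.below x) (h : x < y) :
    W.left ∈ letterSpan {h | h • E.pt < y} :=
  letterSpan_mono (fun _ hh => lt_of_le_of_lt hh h) hW.2

theorem mem_below_of_lt {x : Ω} {W : FreeExtension G} (hf : W.right • x = x)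
    (hW : W.left ∈ letterSpan {h | h • E.pt < x}) : W ∈ E.below x :=
  ⟨hf, letterSpan_mono (fun _ hh => le_of_lt hh) hW⟩

theorem below_mono {x y : Ω} (h : x ≤ y) : E.below x ≤ E.below y := fun _ hW =>
  ⟨E.fixed_mono h hW.1, letterSpan_mono (fun _ hh => le_trans hh h) hW.2⟩

namespace ExtSign

variable {W V : FreeExtension G} {s t : SignType} {m n : ℕ} {x : Ω}

theorem mono (h : m ≤ n) (hW : E.ExtSign m W s) : E.ExtSign n W s := by
  induction m generalizing n W s with
  | zero => exact hW.elim
  | succ m ih =>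
    obtain ⟨n, rfl⟩ : ∃ k, n = k + 1 := ⟨n - 1, by omega⟩
    rcases hW with hW | ⟨x, hx, hW⟩
    · exact Or.inl hW
    · exact Or.inr ⟨x, hx, hW.mono fun _ _ => ih (by omega)⟩

theorem of_moved (h : W.left ∈ letterSpan (E.moved W.right)) :
    E.ExtSign 1 W (coneSign E.P W.right) := Or.inl ⟨h, rfl⟩

theorem one : E.ExtSign 1 1 0 := by
  have := of_moved (E := E) (W := 1) (one_mem _)
  rwa [SemidirectProduct.one_right, coneSign_one E.isBiPosCone.1] at this

theorem eq_zero_of_one (h : E.ExtSign n 1 s) : s = 0 := by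
  induction n generalizing s with
  | zero => exact h.elim
  | succ n ih =>
    rcases h with ⟨-, h⟩ | ⟨x, -, h⟩
    · rw [h, SemidirectProduct.one_right, coneSign_one E.isBiPosCone.1]
    · rw [localize_one, ← map_one single] at h
      exact ih (h.of_single fun _ => ih)

theorem pos_of (h : E.ExtSign n W s) : 1 ≤ n := by
  cases n with
  | zero => exact h.elim
  | succ n => omega

theorem localize_of_lt (hW : W.left ∈ letterSpan {h | h • E.pt < x}) (h : E.ExtSign n W s) :
    WreathSign (E.ExtSign n) (E.localize x W) s := by
  rw [E.localize_of_lt hW]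
  exact WreathSign.single (one.mono h.pos_of) h

theorem of_localize_of_lt (hW : W.left ∈ letterSpan {h | h • E.pt < x})
    (h : WreathSign (E.ExtSign n) (E.localize x W) s) : E.ExtSign n W s := by
  rw [E.localize_of_lt hW] at h
  exact h.of_single fun _ => eq_zero_of_one

theorem unique (hs : E.ExtSign m W s) (ht : E.ExtSign n W t) : s = t := by
  obtain ⟨N, hN⟩ : ∃ N, m + n ≤ N := ⟨_, le_rfl⟩
  induction N generalizing m n W s t with
  | zero =>
    have := hs.pos_of
    omega
  | succ N ih =>
    cases m with
    | zero => exact hs.elim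
    | succ m =>
    cases n with
    | zero => exact ht.elim
    | succ n =>
    rcases id hs with ⟨h1, rfl⟩ | ⟨x, hx, h1⟩ <;> rcases id ht with ⟨g1, rfl⟩ | ⟨y, hy, g1⟩
    · rfl
    · exact ih hs (of_localize_of_lt (letterSpan_mono (moved_subset hy.1) h1) g1) (by omega)
    · exact ih (of_localize_of_lt (letterSpan_mono (moved_subset hx.1) g1) h1) ht (by omega)
    · rcases lt_trichotomy x y with hlt | rfl | hlt
      · exact ih hs (of_localize_of_lt (left_mem_of_below_of_lt hx hlt) g1) (by omega)
      · exact h1.unique (fun a s t (ha : E.ExtSign m a s) (hb : E.ExtSign n a t) =>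
          ih ha hb (by omega)) g1
      · exact ih (of_localize_of_lt (left_mem_of_below_of_lt hy hlt) h1) ht (by omega)

theorem inv (h : E.ExtSign n W s) : E.ExtSign n W⁻¹ (-s) := by
  induction n generalizing W s with
  | zero => exact h.elim
  | succ n ih =>
    rcases h with ⟨h1, rfl⟩ | ⟨x, hx, h1⟩
    · refine Or.inl ⟨?_, (coneSign_inv E.isBiPosCone.1 _).symm⟩
      refine letterShift_mem_letterSpan (fun h hh => ?_) (inv_mem h1)
      simp only [moved, Set.mem_ofPred_eq, SemidirectProduct.inv_right, mul_smul, ne_eq,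
        inv_smul_eq_iff, smul_inv_smul] at hh ⊢
      exact fun e => hh e.symm
    · refine Or.inr ⟨x, inv_mem hx, ?_⟩
      rw [E.localize_inv hx.1]
      exact h1.inv fun a s => ih

theorem conj_inr (a : G) (h : E.ExtSign n W s) :
    E.ExtSign n (SemidirectProduct.inr a * W * (SemidirectProduct.inr a)⁻¹) s := by
  induction n generalizing W s a with
  | zero => exact h.elim
  | succ n ih =>
    have hl : (SemidirectProduct.inr a * W * (SemidirectProduct.inr a)⁻¹).left =
        letterShift G a W.left := by simp
    have hr : (SemidirectProduct.inr a * W * (SemidirectProduct.inr a)⁻¹).right =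
        a * W.right * a⁻¹ := by simp
    rcases h with ⟨h1, rfl⟩ | ⟨x, hx, h1⟩
    · left
      rw [hl, hr, coneSign_conj E.isBiPosCone]
      refine ⟨letterShift_mem_letterSpan (fun h hh => ?_) h1, rfl⟩
      simpa [moved, mul_smul] using hh
    · refine Or.inr ⟨a • x, ⟨?_, ?_⟩, ?_⟩
      · rw [hr, mul_smul, mul_smul, inv_smul_smul, hx.1]
      · rw [hl]
        refine letterShift_mem_letterSpan (fun h hh => ?_) hx.2
        simpa [mul_smul] using E.smul_le a hh
      · rw [E.localize_conj]
        refine h1.conj_base (single (SemidirectProduct.inr a) : Local G).left fun i s hi => ?_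
        rcases eq_or_ne i 1 with rfl | hi1
        · rw [single_left_one]
          exact ih a hi
        · rwa [single_left_ne _ hi1, one_mul, inv_one, mul_one]

theorem mul (hW : E.ExtSign m W s) (hV : E.ExtSign n V t) (hs : 0 ≤ s) (ht : 0 ≤ t) :
    E.ExtSign (m + n) (W * V) (max s t) := by
  obtain ⟨N, hN⟩ : ∃ N, m + n ≤ N := ⟨_, le_rfl⟩
  induction N generalizing m n W V s t with
  | zero =>
    have := hW.pos_of
    omega
  | succ N ih =>
    have step : ∀ {m' n'} (x : Ω), m' + n' + 1 ≤ m + n → W ∈ E.below x → V ∈ E.below x →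
        WreathSign (E.ExtSign m') (E.localize x W) s →
        WreathSign (E.ExtSign n') (E.localize x V) t → E.ExtSign (m + n) (W * V) (max s t) := by
      intro m' n' x hmn hx hy h1 g1
      refine mono hmn (Or.inr ⟨x, mul_mem hx hy, ?_⟩)
      rw [E.localize_mul hx.1]
      exact h1.mul (fun a b s t hs ht ha hb => ih ha hb hs ht (by omega)) g1 hs ht
    cases m with
    | zero => exact hW.elim
    | succ m =>
    cases n with
    | zero => exact hV.elim
    | succ n =>
    have hone : ∀ {U : FreeExtension G}, U.left ∈ letterSpan (E.moved U.right) → U.right = 1 →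
        U = 1 := by
      intro U hU h1
      rw [h1] at hU
      have : E.moved (1 : G) = ∅ := by simp [moved]
      rw [this, letterSpan, Set.image_empty, Subgroup.closure_empty, Subgroup.mem_bot] at hU
      exact SemidirectProduct.ext hU h1
    rcases id hW with ⟨h1, rfl⟩ | ⟨x, hx, h1⟩
    · rcases coneSign_nonneg_iff.1 hs with hf1 | hf1
      · rw [hone h1 hf1, one_mul, SemidirectProduct.one_right, coneSign_one E.isBiPosCone.1,
          max_eq_right ht]
        exact hV.mono (by omega)
      rcases id hV with ⟨g1, rfl⟩ | ⟨x, hx, g1⟩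
      · rcases coneSign_nonneg_iff.1 ht with hf2 | hf2
        · rw [hone g1 hf2, mul_one, SemidirectProduct.one_right, coneSign_one E.isBiPosCone.1,
            max_eq_left hs]
          exact hW.mono (by omega)
        refine Or.inl ⟨mul_mem (letterSpan_mono (fun h hh => ?_) h1)
          (letterShift_mem_letterSpan (fun h hh => ?_) g1), ?_⟩
        · exact (E.mul_moves hf1 hf2 hh).1
        · have := (E.mul_moves hf2 hf1 hh).1
          rw [SemidirectProduct.mul_right, moved]
          simpa [mul_smul] using this
        · rw [coneSign_eq_one_iff.2 hf1, coneSign_eq_one_iff.2 hf2, SemidirectProduct.mul_right,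
            coneSign_eq_one_iff.2 (E.isBiPosCone.1.1 _ hf1 _ hf2), max_self]
      · by_cases hfx : W.right • x = x
        · have hlt := letterSpan_mono (moved_subset hfx) h1
          exact step x (by omega) (mem_below_of_lt hfx hlt) hx (hW.localize_of_lt hlt) g1
        have hne : (W.right * V.right) • x ≠ x := by rwa [mul_smul, hx.1]
        have hne' : (V.right * W.right) • x ≠ x := fun h => hfx (by
          rw [mul_smul] at h
          exact smul_left_cancel V.right (h.trans hx.1.symm))
        refine Or.inl ⟨mul_mem (letterSpan_mono (fun h hh => ?_) h1)
          (letterShift_mem_letterSpan (fun h hh => ?_) hx.2), ?_⟩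
        · intro e
          rcases le_total (h • E.pt) x with hle | hle
          · exact hne (E.fixed_mono hle e)
          · rw [SemidirectProduct.mul_right, mul_smul, E.fixed_mono hle hx.1] at e
            exact hh e
        · intro e
          rw [SemidirectProduct.mul_right, mul_smul, mul_smul, smul_left_cancel_iff,
            ← mul_smul] at e
          exact hne' (E.fixed_mono hh e)
        · rw [coneSign_eq_one_iff.2 hf1, SemidirectProduct.mul_right,
            coneSign_eq_one_iff.2 (E.mul_mem_cone hf1 hfx hx.1).1,
            max_eq_left (SignType.le_one _)]
    · rcases id hV with ⟨g1, rfl⟩ | ⟨y, hy, g1⟩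
      · rcases coneSign_nonneg_iff.1 ht with hf2 | hf2
        · rw [hone g1 hf2, mul_one, SemidirectProduct.one_right, coneSign_one E.isBiPosCone.1,
            max_eq_left hs]
          exact hW.mono (by omega)
        by_cases hfx : V.right • x = x
        · have hlt := letterSpan_mono (moved_subset hfx) g1
          exact step x (by omega) hx (mem_below_of_lt hfx hlt) h1 (hV.localize_of_lt hlt)
        have hne : (V.right * W.right) • x ≠ x := by rwa [mul_smul, hx.1]
        have hne' : (W.right * V.right) • x ≠ x := fun h => hfx (by
          rw [mul_smul] at h
          exact smul_left_cancel W.right (h.trans hx.1.symm))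
        refine Or.inl ⟨mul_mem (letterSpan_mono (fun h hh => ?_) hx.2)
          (letterShift_mem_letterSpan (fun h hh => ?_) g1), ?_⟩
        · exact fun e => hne' (E.fixed_mono hh e)
        · intro e
          rw [SemidirectProduct.mul_right, mul_smul, mul_smul, smul_left_cancel_iff,
            ← mul_smul] at e
          rcases le_total (h • E.pt) x with hle | hle
          · exact hne (E.fixed_mono hle e)
          · rw [mul_smul, E.fixed_mono hle hx.1] at e
            exact hh e
        · rw [coneSign_eq_one_iff.2 hf2, SemidirectProduct.mul_right,
            coneSign_eq_one_iff.2 (E.mul_mem_cone hf2 hfx hx.1).2,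
            max_eq_right (SignType.le_one _)]
      · rcases lt_trichotomy x y with hlt | rfl | hlt
        · exact step y (by omega) (below_mono hlt.le hx) hy
            (hW.localize_of_lt (left_mem_of_below_of_lt hx hlt)) g1
        · exact step x (by omega) hx hy h1 g1
        · exact step x (by omega) hx (below_mono hlt.le hy) h1
            (hV.localize_of_lt (left_mem_of_below_of_lt hy hlt))

end ExtSign

end ConvexAction

namespace ConvexAction
variable {G Ω : Type*} [Group G] [LinearOrder Ω] [MulAction G Ω] {E : ConvexAction G Ω}

/-- The new generator of the free extension. -/
def newGen (G : Type*) [Group G] : FreeExtension G := SemidirectProduct.inl (of 1)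

theorem newGen_mem_below : newGen G ∈ E.below E.pt :=
  ⟨one_smul _ _, of_mem_letterSpan (by simp)⟩

theorem localize_newGen : E.localize E.pt (newGen G) = shift G := by
  simp [localize, letterHom, newGen, letterImage]

theorem ExtSign.conj_newGen {n : ℕ} {W : FreeExtension G} {s : SignType} (h : E.ExtSign n W s) :
    E.ExtSign (n + 1) (newGen G * W * (newGen G)⁻¹) s := by
  have hpt : ∀ {n W s}, W ∈ E.below E.pt → WreathSign (E.ExtSign n) (E.localize E.pt W) s →
      E.ExtSign (n + 1) (newGen G * W * (newGen G)⁻¹) s := by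
    intro n W s hW h
    refine Or.inr ⟨E.pt, mul_mem (mul_mem newGen_mem_below hW) (inv_mem newGen_mem_below), ?_⟩
    rw [E.localize_mul (mul_mem newGen_mem_below hW).1, E.localize_mul newGen_mem_below.1,
      E.localize_inv newGen_mem_below.1, localize_newGen]
    exact h.conj_shift _
  have hlt : ∀ {n W s}, W.right • E.pt = E.pt → W.left ∈ letterSpan {h | h • E.pt < E.pt} →
      E.ExtSign n W s → E.ExtSign (n + 1) (newGen G * W * (newGen G)⁻¹) s := fun h1 h2 h =>
    hpt (mem_below_of_lt h1 h2) (h.localize_of_lt h2)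
  induction n generalizing W s with
  | zero => exact h.elim
  | succ n ih =>
    rcases id h with ⟨h1, rfl⟩ | ⟨x, hx, h1⟩
    · by_cases hf : W.right • E.pt = E.pt
      · exact hlt hf (letterSpan_mono (moved_subset hf) h1) h
      · have hl : (newGen G * W * (newGen G)⁻¹).left = of 1 * W.left * (of W.right)⁻¹ := by
          simp [newGen]
        have hr : (newGen G * W * (newGen G)⁻¹).right = W.right := by simp [newGen]
        left
        rw [hl, hr]
        refine ⟨mul_mem (mul_mem (of_mem_letterSpan ?_) h1) (inv_mem (of_mem_letterSpan ?_)), rfl⟩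
        · simpa [moved] using hf
        · simpa [moved] using hf
    · rcases lt_trichotomy x E.pt with hxp | rfl | hxp
      · exact hlt (E.fixed_mono hxp.le hx.1) (left_mem_of_below_of_lt hx hxp) h
      · exact (hpt hx h1).mono (n + 1).le_succ
      · have hz := below_mono hxp.le (newGen_mem_below (E := E))
        refine Or.inr ⟨x, mul_mem (mul_mem hz hx) (inv_mem hz), ?_⟩
        rw [E.localize_mul (mul_mem hz hx).1, E.localize_mul hz.1, E.localize_inv hz.1,
          E.localize_of_lt (left_mem_of_below_of_lt newGen_mem_below hxp), single_def]
        refine h1.conj_base _ fun i s hi => ?_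
        classical
        by_cases hi1 : i = 1
        · subst hi1
          simpa using ih hi
        · have hs := single_left_ne (newGen G) hi1
          rw [single_def, baseHom_left] at hs
          rw [hs, one_mul, inv_one, mul_one]
          exact hi.mono n.le_succ

section Total

/-- The word part of `W` is given by a list of length at most `n`. -/
def WordLengthLE (n : ℕ) (W : FreeExtension G) : Prop :=
  ∃ L : List (G × Bool), L.length ≤ n ∧ FreeGroup.mk L = W.left

theorem WordLengthLE.mul {m n : ℕ} {W V : FreeExtension G} (hW : WordLengthLE m W)
    (hV : WordLengthLE n V) : WordLengthLE (m + n) (W * V) := by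
  obtain ⟨L, hL, h1⟩ := hW
  obtain ⟨M, hM, h2⟩ := hV
  refine ⟨L ++ M.map fun a => (W.right * a.1, a.2), by simpa using add_le_add hL hM, ?_⟩
  rw [← FreeGroup.mul_mk, h1, SemidirectProduct.mul_left, ← h2]
  rfl

theorem WordLengthLE.inv {n : ℕ} {W : FreeExtension G} (hW : WordLengthLE n W) :
    WordLengthLE n W⁻¹ := by
  obtain ⟨L, hL, h1⟩ := hW
  refine ⟨(FreeGroup.invRev L).map fun a => (W.right⁻¹ * a.1, a.2), by simpa using hL, ?_⟩
  rw [SemidirectProduct.inv_left, ← h1, FreeGroup.inv_mk]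
  rfl

theorem wordLengthLE_inr (f : G) : WordLengthLE 0 (SemidirectProduct.inr f : FreeExtension G) :=
  ⟨[], le_rfl, rfl⟩

/-- Only finitely many coordinates of `w` are nontrivial, and all have word length at most `n`. -/
def LocalLengthLE (n : ℕ) (w : Local G) : Prop :=
  (∀ i, WordLengthLE n (w.left i)) ∧ {i | w.left i ≠ 1}.Finite

theorem LocalLengthLE.mul {m n : ℕ} {w v : Local G} (hw : LocalLengthLE m w)
    (hv : LocalLengthLE n v) : LocalLengthLE (m + n) (w * v) := by
  refine ⟨fun i => (hw.1 i).mul (hv.1 _), ?_⟩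
  refine (hw.2.union (hv.2.preimage (mul_right_injective w.right⁻¹).injOn)).subset fun i hi => ?_
  by_contra h
  simp only [Set.mem_union, Set.mem_preimage, Set.mem_ofPred_eq, not_or, not_not] at h
  exact hi (by simp [h.1, h.2])

theorem LocalLengthLE.inv {n : ℕ} {w : Local G} (hw : LocalLengthLE n w) :
    LocalLengthLE n w⁻¹ := by
  refine ⟨fun i => (hw.1 _).inv, ?_⟩
  refine (hw.2.preimage (mul_right_injective w.right).injOn).subset fun i hi => ?_
  simpa using hi

theorem LocalLengthLE.of_single {n : ℕ} {W : FreeExtension G} (h : WordLengthLE n W) :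
    LocalLengthLE n (single W) := by
  refine ⟨fun i => ?_, (Set.finite_singleton 1).subset fun i hi => ?_⟩
  · by_cases hi : i = 1
    · subst hi
      simpa using h
    · rw [single_left_ne _ hi]
      exact ⟨[], Nat.zero_le _, rfl⟩
  · by_contra h
    exact hi (single_left_ne _ h)

theorem localLengthLE_letterImage (x : Ω) (h : G) [Decidable (h • E.pt = x)] :
    LocalLengthLE (if h • E.pt = x then 0 else 1) (E.letterImage x h) := by
  unfold letterImage
  split_ifs with hx
  · have h1 : LocalLengthLE 0 (shift G) :=
      ⟨fun i => ⟨[], le_rfl, rfl⟩, by simp [shift]⟩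
    have h2 := LocalLengthLE.of_single (wordLengthLE_inr h)
    exact (h2.mul h1).mul h2.inv
  · exact LocalLengthLE.of_single ⟨[(h, true)], le_rfl, rfl⟩

open Classical in
theorem localLengthLE_letterHom (x : Ω) (L : List (G × Bool)) :
    LocalLengthLE (L.countP fun a => a.1 • E.pt ≠ x) (E.letterHom x (FreeGroup.mk L)) := by
  induction L with
  | nil =>
    have : LocalLengthLE 0 (single 1 : Local G) := LocalLengthLE.of_single ⟨[], le_rfl, rfl⟩
    rw [map_one] at this
    rwa [← FreeGroup.one_eq_mk, map_one]
  | cons a L ih =>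
    have h1 : LocalLengthLE (if a.1 • E.pt = x then 0 else 1)
        (E.letterHom x (FreeGroup.mk [a])) := by
      have := localLengthLE_letterImage (E := E) x a.1
      obtain ⟨g, ε⟩ := a
      cases ε
      · simpa [letterHom] using this.inv
      · simpa [letterHom] using this
    rw [← List.singleton_append, ← FreeGroup.mul_mk, map_mul, List.countP_append]
    refine LocalLengthLE.mul ?_ ih
    convert h1 using 1
    by_cases h : a.1 • E.pt = x <;> simp [h]

theorem exists_extSign_of_wordLengthLE (n : ℕ) (W : FreeExtension G) (h : WordLengthLE n W) :
    ∃ m s, E.ExtSign m W s := by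
  classical
  induction n using Nat.strong_induction_on generalizing W with
  | _ n ih =>
  obtain ⟨L, hL, hW⟩ := h
  rcases L.eq_nil_or_concat with rfl | hne
  · refine ⟨1, _, ExtSign.of_moved ?_⟩
    rw [← hW]
    exact one_mem _
  have hne : L ≠ [] := by
    obtain ⟨_, _, rfl⟩ := hne
    simp
  obtain ⟨a, ha, hmax⟩ := L.toFinset.exists_max_image (fun a => a.1 • E.pt)
    (by simpa using hne)
  simp only [List.mem_toFinset] at ha hmax
  by_cases hf : W.right • a.1 • E.pt = a.1 • E.pt
  · have hloc : LocalLengthLE (L.countP fun b => b.1 • E.pt ≠ a.1 • E.pt)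
        (E.localize (a.1 • E.pt) W) := by
      rw [localize, ← hW]
      exact (localLengthLE_letterHom _ _).mul (LocalLengthLE.of_single (wordLengthLE_inr _))
    have hlt : (L.countP fun b => b.1 • E.pt ≠ a.1 • E.pt) < n := by
      refine lt_of_lt_of_le (lt_of_le_of_ne List.countP_le_length fun h => ?_) hL
      have := List.countP_eq_length.1 h a ha
      simp at this
    obtain ⟨m, s, h⟩ := WreathSign.exists_of_finite (R := fun m => E.ExtSign m)
      (fun _ _ _ _ h hm => hm.mono h) ExtSign.one _ hloc.2 fun i => ih _ hlt _ (hloc.1 i)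
    refine ⟨m + 1, s, Or.inr ⟨_, ⟨hf, ?_⟩, h⟩⟩
    rw [← hW]
    exact mem_letterSpan_of_forall L hmax
  · refine ⟨1, _, ExtSign.of_moved ?_⟩
    rw [← hW]
    exact mem_letterSpan_of_forall L fun b hb hfix => hf (E.fixed_mono (hmax b hb) hfix)

variable (E) in
theorem exists_extSign (W : FreeExtension G) : ∃ s m, E.ExtSign m W s := by
  obtain ⟨L, hL⟩ := Quot.exists_rep W.left
  obtain ⟨m, s, h⟩ := exists_extSign_of_wordLengthLE (E := E) _ W ⟨L, le_rfl, hL⟩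
  exact ⟨s, m, h⟩

end Total

variable (E) in
/-- The sign of an element of the free extension. -/
noncomputable def extSign (W : FreeExtension G) : SignType := (E.exists_extSign W).choose

theorem extSign_spec (W : FreeExtension G) : ∃ n, E.ExtSign n W (E.extSign W) :=
  (E.exists_extSign W).choose_spec

theorem ExtSign.eq {n : ℕ} {W : FreeExtension G} {s : SignType} (h : E.ExtSign n W s) :
    E.extSign W = s := by
  obtain ⟨m, hm⟩ := E.extSign_spec W
  exact hm.unique h

theorem extSign_one : E.extSign 1 = 0 := ExtSign.one.eq

theorem extSign_inv (W : FreeExtension G) : E.extSign W⁻¹ = -E.extSign W := by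
  obtain ⟨n, h⟩ := E.extSign_spec W
  exact h.inv.eq

theorem extSign_mul {W V : FreeExtension G} (hW : 0 ≤ E.extSign W) (hV : 0 ≤ E.extSign V) :
    E.extSign (W * V) = max (E.extSign W) (E.extSign V) := by
  obtain ⟨m, hm⟩ := E.extSign_spec W
  obtain ⟨n, hn⟩ := E.extSign_spec V
  exact (hm.mul hn hW hV).eq

theorem extSign_conj (U W : FreeExtension G) : E.extSign (U * W * U⁻¹) = E.extSign W := by
  let H : Subgroup (FreeExtension G) :=
    { carrier := {U | ∀ W, E.extSign (U * W * U⁻¹) = E.extSign W}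
      one_mem' := fun W => by simp
      mul_mem' := fun {U V} hU hV W => by
        rw [← hV W, ← hU (V * W * V⁻¹)]
        congr 1
        group
      inv_mem' := fun {U} hU W => by
        rw [← hU]
        congr 1
        group }
  have hinr : ∀ a, SemidirectProduct.inr a ∈ H := fun a W => by
    obtain ⟨n, h⟩ := E.extSign_spec W
    exact (h.conj_inr a).eq
  have hz : newGen G ∈ H := fun W => by
    obtain ⟨n, h⟩ := E.extSign_spec W
    exact h.conj_newGen.eq
  have hinl : (⊤ : Subgroup (FreeGroup G)) ≤ H.comap SemidirectProduct.inl := by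
    rw [← FreeGroup.closure_range_of, Subgroup.closure_le]
    rintro _ ⟨g, rfl⟩
    have := H.mul_mem (H.mul_mem (hinr g) hz) (H.inv_mem (hinr g))
    rw [newGen, ← map_inv, ← SemidirectProduct.inl_aut, letterShift_of, mul_one] at this
    exact this
  have hU : U ∈ H := by
    rw [← SemidirectProduct.inl_left_mul_inr_right U]
    exact H.mul_mem (hinl (Subgroup.mem_top _)) (hinr _)
  exact hU W

end ConvexAction

section CosetAction

variable {G : Type*} [Group G] [LinearOrder G] [MulLeftMono G] [MulRightMono G] {w : G}

theorem isBiPosCone_one_lt : IsBiPosCone {g : G | 1 < g} := by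
  refine ⟨⟨fun a ha b hb => one_lt_mul'' ha hb, fun g => ?_⟩, fun g p hp => one_lt_conj_iff.2 hp⟩
  simp only [Set.mem_ofPred_eq, one_lt_inv']
  rcases lt_trichotomy g 1 with h | rfl | h
  · exact Or.inr (Or.inr ⟨h, h.ne, h.not_gt⟩)
  · simp
  · exact Or.inr (Or.inl ⟨h, h.ne', h.not_gt⟩)

/-- The conjugate of `convexBelow hw` stabilizing a coset, recorded as a lower set. -/
noncomputable def cosetRank (hw : 1 < w) (x : G ⧸ convexBelow hw) : LowerSet G :=
  powBelow (x.out * w * x.out⁻¹)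

theorem cosetRank_mk (hw : 1 < w) (g : G) :
    cosetRank hw (g : G ⧸ convexBelow hw) = powBelow (g * w * g⁻¹) := by
  obtain ⟨⟨d, hd⟩, h⟩ := QuotientGroup.mk_out_eq_mul (convexBelow hw) g
  have := powBelow_conj_of_mem hw hd
  rw [cosetRank, h]
  refine le_antisymm ?_ ?_
  · simpa [mul_assoc] using powBelow_conj_le this.le g
  · simpa [mul_assoc] using powBelow_conj_le this.ge g

theorem smul_coset_eq_iff (hw : 1 < w) {f : G} {x : G ⧸ convexBelow hw} :
    f • x = x ↔ f ∈ cosetRank hw x ∧ f⁻¹ ∈ cosetRank hw x := by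
  induction x using QuotientGroup.induction_on with
  | H g =>
  have h1 : f • (g : G ⧸ convexBelow hw) = ((f * g : G) : G ⧸ convexBelow hw) := rfl
  rw [h1, cosetRank_mk, mem_powBelow_conj_iff, mem_powBelow_conj_iff, eq_comm, QuotientGroup.eq,
    mem_convexBelow_iff]
  simp [mul_assoc]

theorem smul_coset_eq_iff_of_one_lt (hw : 1 < w) {f : G} (hf : 1 < f) {x : G ⧸ convexBelow hw} :
    f • x = x ↔ f ∈ cosetRank hw x := by
  rw [smul_coset_eq_iff, and_iff_left]
  exact mem_powBelow_of_le_one (one_lt_conj_iff.2 hw) (inv_le_one'.2 hf.le)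

/-- Cosets are ordered by their stabilizers, and lexicographically by representatives. -/
noncomputable instance cosetLinearOrder (hw : 1 < w) : LinearOrder (G ⧸ convexBelow hw) :=
  LinearOrder.lift' (fun x => toLex (cosetRank hw x, x.out)) fun x y h => by
    have : x.out = y.out := congrArg (fun p => (ofLex p).2) h
    rw [← x.out_eq', this, y.out_eq']

theorem coset_le_iff (hw : 1 < w) {x y : G ⧸ convexBelow hw} :
    x ≤ y ↔ cosetRank hw x < cosetRank hw y ∨
      cosetRank hw x = cosetRank hw y ∧ x.out ≤ y.out := Prod.Lex.le_iff

theorem coset_lt_iff (hw : 1 < w) {x y : G ⧸ convexBelow hw} :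
    x < y ↔ cosetRank hw x < cosetRank hw y ∨
      cosetRank hw x = cosetRank hw y ∧ x.out < y.out := Prod.Lex.lt_iff

theorem cosetRank_mono (hw : 1 < w) {x y : G ⧸ convexBelow hw} (h : x ≤ y) :
    cosetRank hw x ≤ cosetRank hw y := by
  rcases (coset_le_iff hw).1 h with h | h
  · exact h.le
  · exact h.1.le

theorem cosetRank_smul (hw : 1 < w) (a : G) (x : G ⧸ convexBelow hw) :
    cosetRank hw (a • x) = powBelow (a * (x.out * w * x.out⁻¹) * a⁻¹) := by
  have : a • x = ((a * x.out : G) : G ⧸ convexBelow hw) := by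
    conv_lhs => rw [← x.out_eq']
    rfl
  rw [this, cosetRank_mk]
  simp [mul_assoc]

theorem out_smul_lt_out_smul (hw : 1 < w) (a : G) {x y : G ⧸ convexBelow hw} (hxy : x ≠ y)
    (h : x.out ≤ y.out) : (a • x).out < (a • y).out := by
  have hout : ∀ z : G ⧸ convexBelow hw, ∃ d ∈ convexBelow hw, (a • z).out = a * z.out * d := by
    intro z
    have : a • z = ((a * z.out : G) : G ⧸ convexBelow hw) := by
      conv_lhs => rw [← z.out_eq']
      rfl
    obtain ⟨⟨d, hd⟩, h⟩ := QuotientGroup.mk_out_eq_mul (convexBelow hw) (a * z.out)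
    exact ⟨d, hd, this ▸ h⟩
  obtain ⟨d, hd, hx⟩ := hout x
  obtain ⟨e, he, hy⟩ := hout y
  have hk : x.out⁻¹ * y.out ∉ convexBelow hw := fun hk => hxy <| by
    rw [← x.out_eq', ← y.out_eq']
    exact QuotientGroup.eq.2 hk
  rw [mem_convexBelow_iff_of_one_le hw (by simpa using h)] at hk
  have hde : d * e⁻¹ < x.out⁻¹ * y.out := by
    by_contra! hle
    exact hk ((powBelow w).lower hle ((convexBelow hw).mul_mem hd ((convexBelow hw).inv_mem he)).1)
  have := mul_lt_mul_left hde e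
  rw [hx, hy, mul_assoc, mul_assoc, mul_lt_mul_iff_left, ← lt_inv_mul_iff_mul_lt, ← mul_assoc]
  simpa using this

/-- The action of a bi-ordered group on the cosets of a convex subgroup. -/
noncomputable def cosetAction (hw : 1 < w) : ConvexAction G (G ⧸ convexBelow hw) where
  P := {g | 1 < g}
  isBiPosCone := isBiPosCone_one_lt
  pt := ((1 : G) : G ⧸ convexBelow hw)
  smul_le a {x y} h := by
    rcases eq_or_ne x y with rfl | hxy
    · exact le_rfl
    rw [coset_le_iff] at h ⊢
    rw [cosetRank_smul, cosetRank_smul]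
    rcases h with h | ⟨h, h'⟩
    · exact Or.inl (powBelow_conj_lt h a)
    · exact Or.inr ⟨(powBelow_conj_le h.le a).antisymm (powBelow_conj_le h.ge a),
        (out_smul_lt_out_smul hw a hxy h').le⟩
  fixed_mono {f x y} h := by
    rw [smul_coset_eq_iff, smul_coset_eq_iff]
    exact fun hf => ⟨cosetRank_mono hw h hf.1, cosetRank_mono hw h hf.2⟩
  mul_moves {f g x} hf hg := by
    rw [Ne, smul_coset_eq_iff_of_one_lt hw hf]
    refine fun h => ⟨?_, ?_⟩
    · rw [Ne, smul_coset_eq_iff_of_one_lt hw (one_lt_mul'' hf hg)]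
      exact fun h' => h ((cosetRank hw x).lower (le_mul_of_one_le_right' (le_of_lt hg)) h')
    · rw [Ne, smul_coset_eq_iff_of_one_lt hw (one_lt_mul'' hg hf)]
      exact fun h' => h ((cosetRank hw x).lower (le_mul_of_one_le_left' (le_of_lt hg)) h')
  mul_mem_cone {f g x} hf := by
    rw [Ne, smul_coset_eq_iff_of_one_lt hw hf, smul_coset_eq_iff]
    rintro h ⟨-, hg⟩
    have hlt : g⁻¹ < f := lt_of_not_ge fun hle => h ((cosetRank hw x).lower hle hg)
    exact ⟨inv_lt_iff_one_lt_mul.1 hlt, inv_lt_iff_one_lt_mul'.1 hlt⟩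

theorem smul_cosetAction_pt_lt (hw : 1 < w) {h : G} (hlt : powBelow (h * w * h⁻¹) < powBelow w) :
    h • (cosetAction hw).pt < (cosetAction hw).pt := by
  have h1 : h • (cosetAction hw).pt = ((h * 1 : G) : G ⧸ convexBelow hw) := rfl
  have h2 : (cosetAction hw).pt = ((1 : G) : G ⧸ convexBelow hw) := rfl
  rw [coset_lt_iff, h1, h2, cosetRank_mk, cosetRank_mk]
  left
  simpa using hlt

theorem smul_cosetAction_pt_eq_iff (hw : 1 < w) {f h : G} :
    f • h • (cosetAction hw).pt = h • (cosetAction hw).pt ↔ h⁻¹ * f * h ∈ convexBelow hw := by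
  have h1 : f • h • (cosetAction hw).pt = ((f * (h * 1) : G) : G ⧸ convexBelow hw) := rfl
  have h2 : h • (cosetAction hw).pt = ((h * 1 : G) : G ⧸ convexBelow hw) := rfl
  rw [h1, h2, eq_comm, QuotientGroup.eq]
  simp [mul_assoc]

end CosetAction

namespace ConvexAction

variable {G Ω : Type*} [Group G] [LinearOrder Ω] [MulAction G Ω] {E : ConvexAction G Ω}

theorem isBiPosCone_extSign {H : Type*} [Group H] (φ : H →* FreeExtension G) {P : Set H}
    (hP : IsBiPosCone P) :
    IsBiPosCone {g | E.extSign (φ g) = 1 ∨ E.extSign (φ g) = 0 ∧ g ∈ P} := by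
  have hs : ∀ s : SignType, s = 0 ∨ s = 1 ∨ s = -1 := by decide
  refine ⟨⟨fun a ha b hb => ?_, fun g => ?_⟩, fun g p hp => ?_⟩
  · have hnn : ∀ {g}, (E.extSign (φ g) = 1 ∨ E.extSign (φ g) = 0 ∧ g ∈ P) →
        0 ≤ E.extSign (φ g) := by
      rintro g (h | h)
      · rw [h]; decide
      · rw [h.1]
    have := extSign_mul (hnn ha) (hnn hb)
    rw [Set.mem_ofPred_eq, map_mul, this]
    rcases ha with ha | ha <;> rcases hb with hb | hb
    · left; rw [ha, hb]; decide
    · left; rw [ha, hb.1]; decide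
    · left; rw [ha.1, hb]; decide
    · right; rw [ha.1, hb.1]; exact ⟨by decide, hP.1.1 _ ha.2 _ hb.2⟩
  · rw [Set.mem_ofPred_eq, Set.mem_ofPred_eq, map_inv, extSign_inv]
    have h1 : E.extSign (φ g) ≠ 0 → g ≠ 1 := by
      rintro h rfl
      exact h (by rw [map_one, extSign_one])
    have := hP.1.2 g
    rcases hs (E.extSign (φ g)) with h | h | h
    · simpa [h] using this
    · simp [h, h1]
    · simp [h, h1]
  · rw [Set.mem_ofPred_eq, map_mul, map_mul, map_inv, extSign_conj]
    exact hp.imp id fun h => ⟨h.1, hP.2 g p h.2⟩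

theorem extSign_conj_newGen_mul_inv {U V : FreeExtension G} (hU : U.right • E.pt = E.pt)
    (hV : V.right • E.pt = E.pt) (hU' : U.left ∈ letterSpan {h | h • E.pt < E.pt})
    (hV' : V.left ∈ letterSpan {h | h • E.pt < E.pt}) (h : E.extSign U = 1) :
    E.extSign (newGen G * U * (newGen G)⁻¹ * V⁻¹) = 1 := by
  have hz := newGen_mem_below (E := E)
  have hUb : U ∈ E.below E.pt := mem_below_of_lt hU hU'
  have hVb : V ∈ E.below E.pt := mem_below_of_lt hV hV'
  have hl : E.localize E.pt (newGen G * U * (newGen G)⁻¹ * V⁻¹) =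
      shift G * single U * (shift G)⁻¹ * (single V)⁻¹ := by
    rw [E.localize_mul (mul_mem (mul_mem hz hUb) (inv_mem hz)).1,
      E.localize_mul (mul_mem hz hUb).1, E.localize_mul hz.1, E.localize_inv hz.1,
      E.localize_inv hV, localize_newGen, E.localize_of_lt hU', E.localize_of_lt hV']
  obtain ⟨n, hn⟩ := E.extSign_spec U
  rw [h] at hn
  have h1 : (Multiplicative.ofAdd (1 : ℤ)) ≠ 1 := by decide
  refine ExtSign.eq (n := n + 2) (Or.inr ⟨E.pt, mul_mem (mul_mem (mul_mem hz hUb) (inv_mem hz))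
    (inv_mem hVb), ?_⟩)
  rw [hl]
  refine Or.inr (Or.inr ⟨by simp [shift], Multiplicative.ofAdd 1, ?_, fun j hj => ?_, by simp⟩)
  · have : (shift G * single U * (shift G)⁻¹ * (single V)⁻¹).left (Multiplicative.ofAdd 1) = U := by
      simp [shift, single_left_ne _ h1]
    rw [this]
    exact hn.mono (by omega)
  · have h2 : j ≠ 1 := (lt_trans (by decide) hj).ne'
    have h3 : (Multiplicative.ofAdd (1 : ℤ))⁻¹ * j ≠ 1 := by
      rw [Ne, inv_mul_eq_one]
      exact hj.ne
    have : (shift G * single U * (shift G)⁻¹ * (single V)⁻¹).left j = 1 := by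
      simp [shift, single_left_ne _ h2, single_left_ne _ h3]
    rw [this]
    exact ExtSign.one.mono (by omega)

end ConvexAction

theorem FreeGroup.mk_false_eq_inv {α : Type*} (b : α) : FreeGroup.mk [(b, false)] = (of b)⁻¹ := rfl

theorem FreeGroup.mk_true_eq_of {α : Type*} (b : α) : FreeGroup.mk [(b, true)] = of b := rfl

section Prefixes

variable {α : Type*} [DecidableEq α]

/-- The initial segments of the reduced word representing `g`. -/
def wordPrefixes (g : FreeGroup α) : Set (FreeGroup α) :=
  FreeGroup.mk '' {L | L <+: g.toWord}

theorem finite_wordPrefixes (g : FreeGroup α) : (wordPrefixes g).Finite := by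
  refine Set.Finite.image _ ((List.finite_toSet g.toWord.inits).subset fun L hL => ?_)
  simpa using hL

theorem norm_conj_le_of_mem_wordPrefixes {f g : FreeGroup α} (hf : f ∈ wordPrefixes g) :
    (f⁻¹ * g * f).norm ≤ g.norm := by
  obtain ⟨L, ⟨M, hM⟩, rfl⟩ := hf
  have : (FreeGroup.mk L)⁻¹ * g * FreeGroup.mk L = FreeGroup.mk (M ++ L) := by
    rw [← g.mk_toWord, ← hM, ← FreeGroup.mul_mk, ← FreeGroup.mul_mk, inv_mul_cancel_left]
  rw [this]
  refine FreeGroup.norm_mk_le.trans ?_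
  rw [FreeGroup.norm, ← hM, List.length_append, List.length_append, add_comm]

theorem FreeGroup.finite_norm_le [Finite α] (n : ℕ) : {g : FreeGroup α | g.norm ≤ n}.Finite :=
  (List.finite_length_le (α × Bool) n).preimage FreeGroup.toWord_injective.injOn

end Prefixes

section Twist

variable {α : Type*} [DecidableEq α]

/-- The homomorphism to the free extension which multiplies the letter `(a, σ)` by `ζ` and fixes
the other generators. -/
def twist (a : α) (σ : Bool) (ζ : FreeExtension (FreeGroup α)) :
    FreeGroup α →* FreeExtension (FreeGroup α) :=
  lift fun i =>
    if i = a then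
      if σ then ζ * SemidirectProduct.inr (of a) else SemidirectProduct.inr (of a) * ζ⁻¹
    else SemidirectProduct.inr (of i)

variable {a : α} {σ : Bool} {ζ : FreeExtension (FreeGroup α)}

theorem twist_self :
    twist a σ ζ (FreeGroup.mk [(a, σ)]) =
      ζ * SemidirectProduct.inr (FreeGroup.mk [(a, σ)]) := by
  cases σ
  · rw [FreeGroup.mk_false_eq_inv, map_inv, map_inv]
    simp [twist]
  · simp [twist, FreeGroup.mk_true_eq_of]

theorem twist_ne {b : α} (hb : b ≠ a) (τ : Bool) :
    twist a σ ζ (FreeGroup.mk [(b, τ)]) = SemidirectProduct.inr (FreeGroup.mk [(b, τ)]) := by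
  cases τ
  · rw [FreeGroup.mk_false_eq_inv, map_inv, map_inv]
    simp [twist, hb]
  · simp [twist, FreeGroup.mk_true_eq_of, hb]

theorem twist_not {τ : Bool} (hσ : σ = !τ) :
    twist a σ ζ (FreeGroup.mk [(a, τ)]) =
      SemidirectProduct.inr (FreeGroup.mk [(a, τ)]) * ζ⁻¹ := by
  subst hσ
  cases τ
  · rw [FreeGroup.mk_false_eq_inv, map_inv, map_inv]
    simp [twist]
  · simp [twist, FreeGroup.mk_true_eq_of]

theorem twist_right (hζ : ζ.right = 1) (g : FreeGroup α) : (twist a σ ζ g).right = g := by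
  have : SemidirectProduct.rightHom.comp (twist a σ ζ) = MonoidHom.id _ := by
    refine FreeGroup.ext_hom _ _ fun i => ?_
    simp only [twist, MonoidHom.comp_apply, FreeGroup.lift_apply_of]
    split_ifs with h <;> simp [hζ, h]
  exact DFunLike.congr_fun this g

theorem twist_mk_left (hr : ζ.right = 1) (hl : ζ.left ∈ letterSpan {1})
    (L : List (α × Bool)) :
    (twist a σ ζ (FreeGroup.mk L)).left ∈ letterSpan (FreeGroup.mk '' {M | M <+: L}) := by
  induction L with
  | nil =>
    rw [← FreeGroup.one_eq_mk, map_one]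
    exact one_mem _
  | cons x L ih =>
    have hx : (twist a σ ζ (FreeGroup.mk [x])).left ∈
        letterSpan (FreeGroup.mk '' {M | M <+: x :: L}) := by
      obtain ⟨b, τ⟩ := x
      rcases eq_or_ne b a with rfl | hb
      · rcases Bool.eq_or_eq_not σ τ with rfl | h
        · rw [twist_self, SemidirectProduct.mul_left, SemidirectProduct.left_inr, map_one, mul_one]
          refine letterSpan_mono ?_ hl
          rintro _ rfl
          exact ⟨[], List.nil_prefix, rfl⟩
        · rw [twist_not h, SemidirectProduct.mul_left, SemidirectProduct.left_inr, one_mul]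
          refine letterShift_mem_letterSpan (S := {1}) ?_ ?_
          · rintro _ rfl
            exact ⟨[(b, τ)], by simp, by simp⟩
          · rw [SemidirectProduct.inv_left, hr, inv_one, map_one]
            exact inv_mem hl
      · rw [twist_ne hb]
        exact one_mem _
    rw [← List.singleton_append, ← FreeGroup.mul_mk, map_mul, SemidirectProduct.mul_left,
      twist_right hr]
    refine mul_mem hx (letterShift_mem_letterSpan ?_ ih)
    rintro _ ⟨M, hM, rfl⟩
    exact ⟨x :: M, List.prefix_cons_inj x |>.2 hM, by rw [FreeGroup.mul_mk]; rfl⟩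

theorem twist_left (hr : ζ.right = 1) (hl : ζ.left ∈ letterSpan {1}) (g : FreeGroup α) :
    (twist a σ ζ g).left ∈ letterSpan (wordPrefixes g) := by
  have := twist_mk_left (a := a) (σ := σ) hr hl g.toWord
  rwa [g.mk_toWord] at this

end Twist

section Flip

variable {G : Type*} [Group G] [LinearOrder G] [MulLeftMono G] [MulRightMono G] {w : G}

/-- Reversing the order on a normal convex subgroup. -/
theorem isBiPosCone_flip (hw : 1 < w) (hn : (convexBelow hw).Normal) :
    IsBiPosCone {g | 1 < g ∧ g ∉ convexBelow hw ∨ g < 1 ∧ g ∈ convexBelow hw} := by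
  have key : ∀ {g d : G}, 1 < g → g ∉ convexBelow hw → d ∈ convexBelow hw → d < g := by
    intro g d hg hgD hd
    by_contra! hle
    rw [mem_convexBelow_iff_of_one_le hw hg.le] at hgD
    exact hgD ((powBelow w).lower hle hd.1)
  refine ⟨⟨fun a ha b hb => ?_, fun g => ?_⟩, fun g p hp => ?_⟩
  · rcases ha with ⟨ha, haD⟩ | ⟨ha, haD⟩ <;> rcases hb with ⟨hb, hbD⟩ | ⟨hb, hbD⟩
    · refine Or.inl ⟨one_lt_mul'' ha hb, fun h => ?_⟩
      exact (key ha haD h).not_ge (le_mul_of_one_le_right' hb.le)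
    · refine Or.inl ⟨inv_lt_iff_one_lt_mul.1 (key ha haD (inv_mem hbD)), fun h => ?_⟩
      exact haD (((convexBelow hw).mul_mem_cancel_right hbD).1 h)
    · refine Or.inl ⟨inv_lt_iff_one_lt_mul'.1 (key hb hbD (inv_mem haD)), fun h => ?_⟩
      exact hbD (((convexBelow hw).mul_mem_cancel_left haD).1 h)
    · exact Or.inr ⟨mul_lt_one ha hb, mul_mem haD hbD⟩
  · simp only [Set.mem_ofPred_eq, one_lt_inv', inv_lt_one', inv_mem_iff]
    rcases lt_trichotomy g 1 with h | rfl | h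
    · have h1 := h.ne
      have h2 := h.not_gt
      tauto
    · simp
    · have h1 := h.ne'
      have h2 := h.not_gt
      tauto
  · have h1 : g * p * g⁻¹ ∈ convexBelow hw ↔ p ∈ convexBelow hw := (hn.mem_comm_iff.trans (by simp))
    have h2 : g * p * g⁻¹ < 1 ↔ p < 1 := by
      have := one_lt_conj_iff (f := g) (g := p⁻¹)
      rwa [one_lt_inv', ← conj_inv, one_lt_inv'] at this
    rw [Set.mem_ofPred_eq, h1, h2, one_lt_conj_iff]
    exact hp

end Flip

open Classical in
/-- The linear order with a given positive cone. -/
noncomputable abbrev IsBiPosCone.linearOrder {G : Type*} [Group G] {P : Set G}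
    (hP : IsBiPosCone P) : LinearOrder G where
  le a b := a = b ∨ a⁻¹ * b ∈ P
  lt a b := a⁻¹ * b ∈ P
  le_refl a := Or.inl rfl
  le_trans a b c := by
    rintro (rfl | h) (rfl | h')
    · exact Or.inl rfl
    · exact Or.inr h'
    · exact Or.inr h
    · right
      simpa [mul_assoc] using hP.1.1 _ h _ h'
  le_antisymm a b := by
    rintro (rfl | h) (h' | h')
    · rfl
    · rfl
    · exact h'.symm
    · refine absurd h' ?_
      simpa using hP.1.inv_notMem h
  lt_iff_le_not_ge a b := by
    have h1 := hP.1.ne_one (g := a⁻¹ * b)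
    have h2 := hP.1.inv_notMem (g := a⁻¹ * b)
    rw [mul_inv_rev, inv_inv] at h2
    rw [Ne, inv_mul_eq_one] at h1
    have h3 : b = a → a = b := Eq.symm
    tauto
  le_total a b := by
    by_cases hab : a = b
    · exact Or.inl (Or.inl hab)
    by_cases h : a⁻¹ * b ∈ P
    · exact Or.inl (Or.inr h)
    · have := hP.1.inv_mem h (by rwa [Ne, inv_mul_eq_one])
      rw [mul_inv_rev, inv_inv] at this
      exact Or.inr (Or.inr this)
  toDecidableLE := Classical.decRel _

section Existence

variable {α : Type*} [LinearOrder (FreeGroup α)] [MulLeftMono (FreeGroup α)]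
  [MulRightMono (FreeGroup α)] {w : FreeGroup α}

theorem exists_le_conj_wordPrefixes [DecidableEq α] [Finite α] [Nontrivial α] {t : FreeGroup α}
    (ht : 1 < t) : ∃ w, 1 < w ∧ w < t ∧ ∀ f ∈ wordPrefixes w, w ≤ f⁻¹ * w * f := by
  obtain ⟨v, hv, hvt⟩ := exists_mem_powBelow ht
  obtain ⟨w, ⟨hwn, hw⟩, hmin⟩ := Set.exists_min_image {g : FreeGroup α | g.norm ≤ v.norm ∧ 1 < g} id
    ((FreeGroup.finite_norm_le v.norm).subset fun g hg => hg.1) ⟨v, le_rfl, hv⟩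
  refine ⟨w, hw, (hmin v ⟨le_rfl, hv⟩).trans_lt (by simpa using hvt 1), fun f hf => ?_⟩
  refine hmin _ ⟨(norm_conj_le_of_mem_wordPrefixes hf).trans hwn, ?_⟩
  simpa using one_lt_conj_iff (f := f⁻¹).2 hw

theorem exists_one_lt_forall_le {G : Type*} [LinearOrder G] [One G] (h : ∃ g : G, 1 < g)
    {T : Set G} (hT : T.Finite) (h1 : ∀ t ∈ T, 1 < t) : ∃ t : G, 1 < t ∧ ∀ s ∈ T, t ≤ s := by
  obtain ⟨g, hg⟩ := h
  obtain ⟨t, ht, hmin⟩ := Set.exists_min_image (insert g T) id (hT.insert g) ⟨g, by simp⟩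
  refine ⟨t, ?_, fun s hs => hmin s (Set.mem_insert_of_mem g hs)⟩
  rcases ht with rfl | ht
  · exact hg
  · exact h1 t ht

theorem normal_convexBelow_of_forall_generator (hw : 1 < w)
    (h : ∀ i, powBelow (of i * w * (of i)⁻¹) = powBelow w) : (convexBelow hw).Normal := by
  have key : ∀ f, powBelow (f * w * f⁻¹) = powBelow w := by
    have hmul : ∀ {f g : FreeGroup α}, powBelow (f * w * f⁻¹) = powBelow w →
        powBelow (g * w * g⁻¹) = powBelow w → powBelow (f * g * w * (f * g)⁻¹) = powBelow w := by
      intro f g hf hg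
      have := (powBelow_conj_le hg.le f).antisymm (powBelow_conj_le hg.ge f)
      rw [← hf, ← this]
      simp [mul_assoc]
    have hinv : ∀ {f : FreeGroup α}, powBelow (f * w * f⁻¹) = powBelow w →
        powBelow (f⁻¹ * w * f⁻¹⁻¹) = powBelow w := by
      intro f hf
      have := (powBelow_conj_le hf.le f⁻¹).antisymm (powBelow_conj_le hf.ge f⁻¹)
      rw [← this]
      simp [mul_assoc]
    intro f
    induction f using FreeGroup.induction_mul_left with
    | one => simp
    | mul a f ih => exact hmul (h a) ih
    | inv_mul a f ih => exact hmul (hinv (h a)) ih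
  refine ⟨fun d hd g => ?_⟩
  rw [mem_convexBelow_iff] at hd ⊢
  rw [← key g, conj_inv, conj_mem_powBelow_iff, conj_mem_powBelow_iff]
  exact hd

theorem exists_isBiPosCone_of_conj_lt [DecidableEq α] (hw : 1 < w)
    (hpre : ∀ f ∈ wordPrefixes w, w ≤ f⁻¹ * w * f) {a b : α} (hab : b ≠ a) {σ τ : Bool}
    (hA : FreeGroup.mk [(a, σ)] * w * (FreeGroup.mk [(a, σ)])⁻¹ ≤ w)
    (hB : powBelow (FreeGroup.mk [(b, τ)] * w * (FreeGroup.mk [(b, τ)])⁻¹) < powBelow w) :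
    ∃ p : FreeGroup α, ∃ Q₁ Q₂ : Set (FreeGroup α), IsBiPosCone Q₁ ∧ IsBiPosCone Q₂ ∧
      p ∈ Q₁ ∧ p ∉ Q₂ ∧ ∀ s, 1 < s → (∀ f ∈ wordPrefixes s, w ≤ f⁻¹ * s * f) → s ∈ Q₁ ∧ s ∈ Q₂ := by
  set A := FreeGroup.mk [(a, σ)] with hAdef
  set B := FreeGroup.mk [(b, τ)] with hBdef
  let E := cosetAction hw
  have hsign : ∀ ζ : FreeExtension (FreeGroup α), ζ.right = 1 → ζ.left ∈ letterSpan {1} →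
      ∀ s, 1 < s → (∀ f ∈ wordPrefixes s, w ≤ f⁻¹ * s * f) → E.extSign (twist a σ ζ s) = 1 := by
    intro ζ hr hl s hs h
    have hm : (twist a σ ζ s).left ∈ letterSpan (E.moved (twist a σ ζ s).right) := by
      rw [twist_right hr]
      refine letterSpan_mono (fun f hf => ?_) (twist_left hr hl s)
      refine fun heq => notMem_powBelow_self (w := w) ?_
      exact (powBelow w).lower (h f hf) ((smul_cosetAction_pt_eq_iff hw).1 heq).1
    rw [(ConvexAction.ExtSign.of_moved hm).eq, coneSign_eq_one_iff, twist_right hr]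
    exact hs
  have hBf : ∀ f ∈ wordPrefixes w, powBelow (B * f * w * (B * f)⁻¹) < powBelow w := by
    intro f hf
    have h1 : f * w * f⁻¹ ≤ w := by
      rw [mul_inv_le_iff_le_mul, ← le_inv_mul_iff_mul_le, ← mul_assoc]
      exact hpre f hf
    refine lt_of_le_of_lt ?_ hB
    simpa [mul_assoc] using powBelow_conj_le (powBelow_mono h1) B
  have hABf : ∀ f ∈ wordPrefixes w,
      powBelow (A * (B * f) * w * (A * (B * f))⁻¹) < powBelow w := by
    intro f hf
    refine lt_of_lt_of_le ?_ (powBelow_mono hA)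
    simpa [mul_assoc] using powBelow_conj_lt (hBf f hf) A
  set q := B * w * B⁻¹ with hq
  have hq1 : 1 < q := one_lt_conj_iff.2 hw
  have hqw : q ∈ powBelow w := by
    by_contra h
    exact (powBelow_le_of_notMem h).not_gt hB
  have hqD : q ∈ convexBelow hw := (mem_convexBelow_iff_of_one_le hw hq1.le).2 hqw
  have hpD : A * q * A⁻¹ ∈ convexBelow hw :=
    (mem_convexBelow_iff_of_one_le hw (one_lt_conj_iff.2 hq1).le).2
      (powBelow_mono hA (conj_mem_powBelow_iff.2 hqw))
  have hfix : ∀ d ∈ convexBelow hw, d • E.pt = E.pt := by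
    intro d hd
    simpa using (smul_cosetAction_pt_eq_iff hw (f := d) (h := 1)).2 (by simpa using hd)
  let V ζ : FreeExtension (FreeGroup α) := twist a σ ζ q
  let U ζ : FreeExtension (FreeGroup α) :=
    SemidirectProduct.inr A * V ζ * (SemidirectProduct.inr A)⁻¹
  have hVdef : ∀ ζ, V ζ =
      SemidirectProduct.inr B * twist a σ ζ w * (SemidirectProduct.inr B)⁻¹ := by
    intro ζ
    simp only [V, hq, hBdef, map_mul, map_inv, twist_ne hab]
  have hp : ∀ ζ, twist a σ ζ (A * q * A⁻¹ * q⁻¹) = ζ * U ζ * ζ⁻¹ * (V ζ)⁻¹ := by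
    intro ζ
    simp only [U, V, hAdef, map_mul, map_inv, twist_self]
    group
  have hVr : ∀ ζ, ζ.right = 1 → (V ζ).right • E.pt = E.pt := by
    intro ζ hr
    rw [twist_right hr]
    exact hfix q hqD
  have hUr : ∀ ζ, ζ.right = 1 → (U ζ).right • E.pt = E.pt := by
    intro ζ hr
    have : (U ζ).right = A * q * A⁻¹ := by simp [U, V, twist_right hr]
    rw [this]
    exact hfix _ hpD
  have hVl : ∀ ζ, ζ.right = 1 → ζ.left ∈ letterSpan {1} →
      (V ζ).left ∈ letterSpan {h | h • E.pt < E.pt} := by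
    intro ζ hr hl
    have : (V ζ).left = letterShift _ B (twist a σ ζ w).left := by simp [hVdef]
    rw [this]
    exact letterShift_mem_letterSpan
      (fun f hf => smul_cosetAction_pt_lt hw (hBf f hf)) (twist_left hr hl w)
  have hUl : ∀ ζ, ζ.right = 1 → ζ.left ∈ letterSpan {1} →
      (U ζ).left ∈ letterSpan {h | h • E.pt < E.pt} := by
    intro ζ hr hl
    have : (U ζ).left = letterShift _ (A * B) (twist a σ ζ w).left := by
      simp [U, hVdef]
    rw [this]
    refine letterShift_mem_letterSpan (fun f hf => ?_) (twist_left hr hl w)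
    rw [mul_assoc]
    exact smul_cosetAction_pt_lt hw (hABf f hf)
  have hVs : ∀ ζ, ζ.right = 1 → ζ.left ∈ letterSpan {1} → E.extSign (V ζ) = 1 := by
    intro ζ hr hl
    rw [hVdef, ConvexAction.extSign_conj]
    exact hsign ζ hr hl w hw hpre
  let z : FreeExtension (FreeGroup α) := ConvexAction.newGen (FreeGroup α)
  have hzr : z.right = 1 := rfl
  have hzl : z.left ∈ letterSpan {1} := of_mem_letterSpan rfl
  have hzr' : z⁻¹.right = 1 := by simp [hzr]
  have hzl' : z⁻¹.left ∈ letterSpan {1} := by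
    rw [SemidirectProduct.inv_left, hzr, inv_one, map_one]
    exact inv_mem hzl
  have hpos : E.extSign (twist a σ z (A * q * A⁻¹ * q⁻¹)) = 1 := by
    rw [hp]
    refine ConvexAction.extSign_conj_newGen_mul_inv (hUr z hzr) (hVr z hzr) (hUl z hzr hzl)
      (hVl z hzr hzl) ?_
    rw [ConvexAction.extSign_conj]
    exact hVs z hzr hzl
  have hneg : E.extSign (twist a σ z⁻¹ (A * q * A⁻¹ * q⁻¹)) = -1 := by
    rw [hp, ← ConvexAction.extSign_conj z]
    have : z * (z⁻¹ * U z⁻¹ * z⁻¹⁻¹ * (V z⁻¹)⁻¹) * z⁻¹ =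
        (z * V z⁻¹ * z⁻¹ * (U z⁻¹)⁻¹)⁻¹ := by group
    rw [this, ConvexAction.extSign_inv, ConvexAction.extSign_conj_newGen_mul_inv (hVr _ hzr')
      (hUr _ hzr') (hVl _ hzr' hzl') (hUl _ hzr' hzl') (hVs _ hzr' hzl')]
  refine ⟨_, _, _, ConvexAction.isBiPosCone_extSign (E := E) (twist a σ z) isBiPosCone_one_lt,
    ConvexAction.isBiPosCone_extSign (E := E) (twist a σ z⁻¹) isBiPosCone_one_lt,
    Or.inl hpos, ?_, fun s hs h => ⟨Or.inl (hsign z hzr hzl s hs h),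
      Or.inl (hsign z⁻¹ hzr' hzl' s hs h)⟩⟩
  rw [Set.mem_ofPred_eq, hneg]
  simp

theorem exists_isBiPosCone_ne_of_one_lt [Finite α] [Nontrivial α] {S : Set (FreeGroup α)}
    (hS : S.Finite) (h1 : ∀ s ∈ S, 1 < s) :
    ∃ Q, IsBiPosCone Q ∧ S ⊆ Q ∧ Q ≠ {g : FreeGroup α | 1 < g} := by
  classical
  have hone : ∃ g : FreeGroup α, 1 < g := by
    obtain ⟨g, hg⟩ := exists_ne (1 : FreeGroup α)
    rcases hg.lt_or_gt with h | h
    · exact ⟨g⁻¹, one_lt_inv'.2 h⟩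
    · exact ⟨g, h⟩
  obtain ⟨t, ht, htS⟩ : ∃ t : FreeGroup α, 1 < t ∧
      ∀ g ∈ ⋃ s ∈ S, (fun f => f⁻¹ * s * f) '' wordPrefixes s, t ≤ g := by
    refine exists_one_lt_forall_le hone
      (hS.biUnion fun s _ => (finite_wordPrefixes s).image _) fun g hg => ?_
    simp only [Set.mem_iUnion] at hg
    obtain ⟨s, hs, f, hf, rfl⟩ := hg
    simpa using one_lt_conj_iff (f := f⁻¹).2 (h1 s hs)
  obtain ⟨w, hw, hwt, hpre⟩ := exists_le_conj_wordPrefixes ht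
  have hSw : ∀ s ∈ S, ∀ f ∈ wordPrefixes s, w < f⁻¹ * s * f := fun s hs f hf =>
    hwt.trans_le (htS _ (Set.mem_biUnion hs ⟨f, hf, rfl⟩))
  by_cases h : ∀ i, powBelow (of i * w * (of i)⁻¹) = powBelow w
  · refine ⟨_, isBiPosCone_flip hw (normal_convexBelow_of_forall_generator hw h),
      fun s hs => Or.inl ⟨h1 s hs, fun hsD => ?_⟩, fun heq => ?_⟩
    · refine notMem_powBelow_self (w := w) ((powBelow w).lower ?_ hsD.1)
      simpa using (hSw s hs 1 ⟨[], List.nil_prefix, rfl⟩).le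
    · obtain ⟨d, hd, hdw⟩ := exists_mem_powBelow hw
      have : d ∈ convexBelow hw := (mem_convexBelow_iff_of_one_le hw hd.le).2 hdw
      have hd' : d ∈ {g : FreeGroup α | 1 < g} := hd
      rw [← heq] at hd'
      rcases hd' with hd' | hd'
      · exact hd'.2 this
      · exact hd'.1.not_gt hd
  · push Not at h
    obtain ⟨b, hb⟩ := h
    obtain ⟨τ, hτ⟩ : ∃ τ, powBelow (FreeGroup.mk [(b, τ)] * w * (FreeGroup.mk [(b, τ)])⁻¹) <
        powBelow w := by
      rcases le_total (of b * w * (of b)⁻¹) w with hle | hle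
      · exact ⟨true, (powBelow_mono hle).lt_of_ne hb⟩
      · refine ⟨false, ?_⟩
        have := powBelow_conj_lt ((powBelow_mono hle).lt_of_ne hb.symm) (of b)⁻¹
        rw [FreeGroup.mk_false_eq_inv]
        simpa [mul_assoc] using this
    obtain ⟨a, hab⟩ := exists_ne b
    obtain ⟨σ, hσ⟩ : ∃ σ, FreeGroup.mk [(a, σ)] * w * (FreeGroup.mk [(a, σ)])⁻¹ ≤ w := by
      rcases le_total (of a * w * (of a)⁻¹) w with hle | hle
      · exact ⟨true, hle⟩
      · refine ⟨false, ?_⟩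
        rw [FreeGroup.mk_false_eq_inv, inv_inv]
        have := mul_le_mul_left (mul_le_mul_right hle (of a)⁻¹) (of a)
        simpa [mul_assoc] using this
    obtain ⟨p, Q₁, Q₂, hQ₁, hQ₂, hp₁, hp₂, hQ⟩ :=
      exists_isBiPosCone_of_conj_lt hw hpre hab.symm hσ hτ
    have hSQ : ∀ s ∈ S, s ∈ Q₁ ∧ s ∈ Q₂ := fun s hs =>
      hQ s (h1 s hs) fun f hf => (hSw s hs f hf).le
    by_cases hne : Q₁ = {g : FreeGroup α | 1 < g}
    · exact ⟨Q₂, hQ₂, fun s hs => (hSQ s hs).2, fun h => hp₂ (by rwa [h, ← hne])⟩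
    · exact ⟨Q₁, hQ₁, fun s hs => (hSQ s hs).1, hne⟩

end Existence

theorem exists_isBiPosCone_ne {α : Type*} [Finite α] [Nontrivial α] {P : Set (FreeGroup α)}
    (hP : IsBiPosCone P) {S : Set (FreeGroup α)} (hS : S.Finite) (hSP : S ⊆ P) :
    ∃ Q, IsBiPosCone Q ∧ S ⊆ Q ∧ Q ≠ P := by
  classical
  let _ : LinearOrder (FreeGroup α) := hP.linearOrder
  have hlt : ∀ a b : FreeGroup α, a < b ↔ a⁻¹ * b ∈ P := fun _ _ => Iff.rfl
  have : MulLeftMono (FreeGroup α) := ⟨fun c a b h => by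
    rcases h.eq_or_lt with rfl | h
    · exact le_rfl
    · refine le_of_lt ?_
      rw [hlt] at h ⊢
      simpa [mul_assoc] using h⟩
  have : MulRightMono (FreeGroup α) := ⟨fun c a b h => by
    rcases h.eq_or_lt with rfl | h
    · exact le_rfl
    · refine le_of_lt ?_
      rw [hlt] at h ⊢
      simpa [mul_assoc, Function.swap] using hP.2 c⁻¹ _ h⟩
  have hPeq : {g : FreeGroup α | 1 < g} = P := by
    ext g
    rw [Set.mem_ofPred_eq, hlt, inv_one, one_mul]
  rw [← hPeq] at hSP ⊢
  exact exists_isBiPosCone_ne_of_one_lt hS hSP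

/-- The space `O(F₂)` of bi-invariant positive cones of the free group on two
generators is homeomorphic to the Cantor set `ℕ → {0,1}`. -/
theorem OSpace_freeGroup_two_homeomorphic_cantor :
    Nonempty (OSpace (FreeGroup (Fin 2)) ≃ₜ (ℕ → Bool)) :=
  nonempty_OSpace_homeomorph_cantor ⟨_, isBiPosCone_magnusCone⟩
    fun _ hP _ hS hSP => exists_isBiPosCone_ne hP hS hSP
end

section
/- Every countable group equipped with a bi-invariant linear order embeds, via an order-preserving injective group homomorphism, into a countable group equipped with a bi-invariant linear order that is strongly dense. -/
section Defs

variable {G : Type*} [Group G] [LinearOrder G]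

/-- The absolute value `|x|` in an ordered group: `x` if `x ≥ 1`, else `x⁻¹`. -/
def oAbs (x : G) : G := if 1 ≤ x then x else x⁻¹

/-- `x ≪ y` (`x` is much less than `y`): `|y| > |x|ⁿ` for every natural number `n`. -/
def MuchLt (x y : G) : Prop := ∀ n : ℕ, oAbs x ^ n < oAbs y

end Defs

/-- A bi-ordered group is strongly dense if `≪` is dense and has no top. -/
def StronglyDense (G : Type*) [Group G] [LinearOrder G] : Prop :=
  (∀ g₁ g₂ : G, MuchLt g₁ g₂ → ∃ g₃ : G, MuchLt g₁ g₃ ∧ MuchLt g₃ g₂) ∧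
  ∀ g₁ : G, ∃ g₂ : G, MuchLt g₁ g₂

/-- A countable group together with a bi-invariant linear order. -/
structure CountableBiOrderedGroup where
  carrier : Type
  [grp : Group carrier]
  [lin : LinearOrder carrier]
  [cnt : Countable carrier]
  mul_lt_mul_left' : ∀ x y z : carrier, x < y → z * x < z * y
  mul_lt_mul_right' : ∀ x y z : carrier, x < y → x * z < y * z

attribute [instance] CountableBiOrderedGroup.grp CountableBiOrderedGroup.lin
  CountableBiOrderedGroup.cnt

section OrderedAbs

variable {G : Type*} [Group G] [LinearOrder G]

theorem oAbs_of_one_le {x : G} (h : 1 ≤ x) : oAbs x = x := if_pos h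

variable [MulLeftMono G]

theorem one_le_oAbs (x : G) : 1 ≤ oAbs x := by
  unfold oAbs
  split_ifs with h
  · exact h
  · exact one_le_inv'.2 (not_le.1 h).le

theorem oAbs_oAbs (x : G) : oAbs (oAbs x) = oAbs x := oAbs_of_one_le (one_le_oAbs x)

/-- It suffices to check strong density on elements `≥ 1`. -/
theorem stronglyDense_of_one_le
    (h₁ : ∀ x y : G, 1 ≤ x → (∀ n : ℕ, x ^ n < y) →
      ∃ z, 1 ≤ z ∧ (∀ n : ℕ, x ^ n < z) ∧ ∀ n : ℕ, z ^ n < y)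
    (h₂ : ∀ x : G, 1 ≤ x → ∃ y, 1 ≤ y ∧ ∀ n : ℕ, x ^ n < y) : StronglyDense G := by
  refine ⟨fun x y hxy => ?_, fun x => ?_⟩
  · obtain ⟨z, hz, hxz, hzy⟩ := h₁ (oAbs x) (oAbs y) (one_le_oAbs x) hxy
    refine ⟨z, ?_, ?_⟩ <;> simpa only [MuchLt, oAbs_of_one_le hz]
  · obtain ⟨y, hy, hxy⟩ := h₂ (oAbs x) (one_le_oAbs x)
    refine ⟨y, ?_⟩
    simpa only [MuchLt, oAbs_of_one_le hy]

end OrderedAbs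

section Ultrapower

open Filter

variable {G : Type*} [Group G] [LinearOrder G]

/-- The ultrapower of `G` along a nonprincipal ultrafilter on `ℕ`. -/
abbrev NatUltrapower (G : Type*) := Germ (hyperfilter ℕ : Filter ℕ) G

theorem germ_mul_lt_mul_left [MulLeftMono G] (x y z : NatUltrapower G) (h : x < y) : z * x < z * y := by
  induction x, y, z using Germ.inductionOn₃ with | _ x y z
  exact Germ.coe_lt.2 ((Germ.coe_lt.1 h).mono fun _ hi => mul_lt_mul_right hi _)

theorem germ_mul_lt_mul_right [MulRightMono G] (x y z : NatUltrapower G) (h : x < y) : x * z < y * z := by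
  induction x, y, z using Germ.inductionOn₃ with | _ x y z
  exact Germ.coe_lt.2 ((Germ.coe_lt.1 h).mono fun _ hi => mul_lt_mul_left hi _)

instance germ_mulLeftMono [MulLeftMono G] : MulLeftMono (NatUltrapower G) :=
  ⟨fun z x y h => by
    rcases h.eq_or_lt with rfl | h
    · exact le_rfl
    · exact (germ_mul_lt_mul_left x y z h).le⟩

theorem eventually_ge_hyperfilter (k : ℕ) : ∀ᶠ i in (hyperfilter ℕ : Filter ℕ), k ≤ i :=
  Nat.hyperfilter_le_atTop (eventually_ge_atTop k)

/-- A countable decreasing family of conditions, each holding almost everywhere, can be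
diagonalised: the index may tend to infinity. -/
theorem exists_index_tendsto {P : ℕ → ℕ → Prop}
    (hP : ∀ k, ∀ᶠ i in (hyperfilter ℕ : Filter ℕ), P k i) :
    ∃ N : ℕ → ℕ, (∀ k, ∀ᶠ i in (hyperfilter ℕ : Filter ℕ), k ≤ N i) ∧
      ∀ᶠ i in (hyperfilter ℕ : Filter ℕ), P (N i) i := by
  classical
  refine ⟨fun i => Nat.findGreatest (fun k => P k i) i, fun k => ?_, ?_⟩
  · filter_upwards [hP k, eventually_ge_hyperfilter k] with i h₁ h₂
    exact Nat.le_findGreatest h₂ h₁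
  · filter_upwards [hP 0] with i hi
    exact Nat.findGreatest_spec (P := fun k => P k i) (Nat.zero_le i) hi

theorem stronglyDense_germ [MulLeftMono G] [MulRightMono G] [Nontrivial G]
    (hd : ∀ y : G, 1 < y → ∀ n : ℕ, ∃ x, 1 < x ∧ x ^ n < y) : StronglyDense (NatUltrapower G) := by
  refine stronglyDense_of_one_le (fun x y hx hxy => ?_) (fun x hx => ?_)
  · induction x, y using Germ.inductionOn₂ with | _ a b
    have hab : ∀ n : ℕ, ∀ᶠ i in (hyperfilter ℕ : Filter ℕ), a i ^ n < b i :=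
      fun n => Germ.coe_lt.1 (hxy n)
    rcases hx.eq_or_lt with h1 | h1
    · have hb : ∀ᶠ i in (hyperfilter ℕ : Filter ℕ), 1 < b i := by simpa using hab 0
      have : ∀ i, ∃ c, 1 < b i → 1 < c ∧ c ^ i < b i := fun i => by
        by_cases h : 1 < b i
        · exact (hd _ h i).imp fun _ hc _ => hc
        · exact ⟨1, fun h' => absurd h' h⟩
      choose c hc using this
      have hc1 : (1 : NatUltrapower G) < (c : NatUltrapower G) := Germ.coe_lt.2 (hb.mono fun i hi => (hc i hi).1)
      refine ⟨c, hc1.le, fun n => ?_, fun n => ?_⟩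
      · rwa [← h1, one_pow]
      · refine Germ.coe_lt.2 ?_
        filter_upwards [hb, eventually_ge_hyperfilter n] with i hi hn
        exact (pow_le_pow_right' (hc i hi).1.le hn).trans_lt (hc i hi).2
    · have ha : ∀ᶠ i in (hyperfilter ℕ : Filter ℕ), 1 < a i := Germ.coe_lt.1 h1
      obtain ⟨N, hN, hNb⟩ := exists_index_tendsto (fun k => hab (k * k))
      refine ⟨((fun i => a i ^ N i : ℕ → G) : NatUltrapower G), ?_, fun n => ?_, fun n => ?_⟩
      · refine Germ.coe_le.2 (ha.mono fun i hi => ?_)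
        exact one_le_pow_of_one_le' hi.le _
      · refine Germ.coe_lt.2 ?_
        filter_upwards [ha, hN (n + 1)] with i hi hn
        exact pow_lt_pow_right' hi hn
      · refine Germ.coe_lt.2 ?_
        filter_upwards [ha, hNb, hN n] with i hi hb hn
        refine lt_of_le_of_lt ?_ hb
        change (a i ^ N i) ^ n ≤ _
        rw [← pow_mul]
        exact pow_le_pow_right' hi.le (Nat.mul_le_mul_left _ hn)
  · induction x using Germ.inductionOn with | _ a
    rcases hx.eq_or_lt with h1 | h1
    · obtain ⟨g, hg⟩ : ∃ g : G, 1 < g := by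
        obtain ⟨g, hg⟩ := exists_ne (1 : G)
        rcases hg.lt_or_gt with h | h
        · exact ⟨g⁻¹, one_lt_inv'.2 h⟩
        · exact ⟨g, h⟩
      have hg1 : (1 : NatUltrapower G) < (g : NatUltrapower G) := Germ.const_lt hg
      exact ⟨_, hg1.le, fun n => by rwa [← h1, one_pow]⟩
    · have ha : ∀ᶠ i in (hyperfilter ℕ : Filter ℕ), 1 < a i := Germ.coe_lt.1 h1
      refine ⟨((fun i => a i ^ i : ℕ → G) : NatUltrapower G), ?_, fun n => ?_⟩
      · refine Germ.coe_le.2 (ha.mono fun i hi => ?_)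
        exact one_le_pow_of_one_le' hi.le _
      · refine Germ.coe_lt.2 ?_
        filter_upwards [ha, eventually_ge_hyperfilter (n + 1)] with i hi hn
        exact pow_lt_pow_right' hi hn

end Ultrapower

section Countable

/-- A countable set is contained in a countable set closed under a countably-valued
binary operation. -/
theorem exists_countable_closed {α : Type*} (F : α → α → Set α) (hF : ∀ x y, (F x y).Countable)
    {S : Set α} (hS : S.Countable) :
    ∃ T : Set α, T.Countable ∧ S ⊆ T ∧ ∀ x ∈ T, ∀ y ∈ T, F x y ⊆ T := by
  let step : Set α → Set α := fun A => A ∪ ⋃ x ∈ A, ⋃ y ∈ A, F x y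
  let A : ℕ → Set α := fun n => step^[n] S
  have hA : ∀ n, A (n + 1) = step (A n) := fun n => Function.iterate_succ_apply' _ _ _
  have hmono : Monotone A := monotone_nat_of_le_succ fun n => by
    rw [hA]
    exact Set.subset_union_left
  refine ⟨⋃ n, A n, Set.countable_iUnion fun n => ?_, Set.subset_iUnion A 0, ?_⟩
  · induction n with
    | zero => exact hS
    | succ n ih =>
      rw [hA]
      exact ih.union (ih.biUnion fun x _ => ih.biUnion fun y _ => hF x y)
  · intro x hx y hy z hz
    obtain ⟨m, hm⟩ := Set.mem_iUnion.1 hx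
    obtain ⟨n, hn⟩ := Set.mem_iUnion.1 hy
    refine Set.mem_iUnion.2 ⟨max m n + 1, ?_⟩
    rw [hA]
    exact Or.inr (Set.mem_biUnion (hmono (le_max_left m n) hm)
      (Set.mem_biUnion (hmono (le_max_right m n) hn) hz))

variable {K : Type*} [Group K] [LinearOrder K]

theorem Subgroup.coe_oAbs (H : Subgroup K) (x : H) : ((oAbs x : H) : K) = oAbs (x : K) := by
  simp only [oAbs, apply_ite Subtype.val, Subgroup.coe_inv]
  rfl

theorem Subgroup.muchLt_coe (H : Subgroup K) (x y : H) :
    MuchLt (x : K) (y : K) ↔ MuchLt x y := by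
  simp only [MuchLt, ← Subgroup.coe_oAbs, ← Subgroup.coe_pow]
  rfl

/-- Every countable subset of a strongly dense group lies in a countable strongly dense
subgroup. -/
theorem StronglyDense.exists_countable_subgroup (hK : StronglyDense K) {S : Set K}
    (hS : S.Countable) : ∃ H : Subgroup K, Countable H ∧ S ⊆ H ∧ StronglyDense H := by
  have hb : ∀ x y : K, ∃ z, MuchLt x y → MuchLt x z ∧ MuchLt z y := fun x y => by
    by_cases h : MuchLt x y
    · exact (hK.1 x y h).imp fun _ hz _ => hz
    · exact ⟨1, fun h' => absurd h' h⟩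
  choose b hb using hb
  choose t ht using hK.2
  obtain ⟨T, hTc, hST, hT⟩ := exists_countable_closed
    (fun x y => ({x * y, x⁻¹, b x y, t x} : Set K)) (fun _ _ => (Set.toFinite _).countable)
    (hS.insert 1)
  let H : Subgroup K :=
    { carrier := T
      one_mem' := hST (Set.mem_insert _ _)
      mul_mem' := fun {x y} hx hy => hT x hx y hy (by simp)
      inv_mem' := fun {x} hx => hT x hx x hx (by simp) }
  refine ⟨H, hTc.to_subtype, (Set.subset_insert 1 S).trans hST, fun x y hxy => ?_, fun x => ?_⟩
  · refine ⟨⟨b x y, hT x x.2 y y.2 (by simp)⟩, ?_⟩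
    simpa only [← Subgroup.muchLt_coe] using hb x y ((H.muchLt_coe x y).2 hxy)
  · refine ⟨⟨t x, hT x x.2 x x.2 (by simp)⟩, ?_⟩
    simpa only [← Subgroup.muchLt_coe] using ht x

end Countable

section LexRat

variable {G : Type*} [Group G] [LinearOrder G]

instance lexRat_mulLeftMono [MulLeftMono G] : MulLeftMono (G ×ₗ Multiplicative ℚ) :=
  ⟨fun z x y h => by
    rcases Prod.Lex.le_iff.1 h with h | ⟨h₁, h₂⟩
    · exact Prod.Lex.le_iff.2 (Or.inl (mul_lt_mul_right h _))
    · exact Prod.Lex.le_iff.2 (Or.inr ⟨congrArg (_ * ·) h₁, mul_le_mul_right h₂ _⟩)⟩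

instance lexRat_mulRightMono [MulRightMono G] : MulRightMono (G ×ₗ Multiplicative ℚ) :=
  ⟨fun z x y h => by
    rcases Prod.Lex.le_iff.1 h with h | ⟨h₁, h₂⟩
    · exact Prod.Lex.le_iff.2 (Or.inl (mul_lt_mul_left h _))
    · exact Prod.Lex.le_iff.2 (Or.inr ⟨congrArg (· * _) h₁, mul_le_mul_left h₂ _⟩)⟩

theorem lexRat_exists_pow_lt (y : G ×ₗ Multiplicative ℚ) (hy : 1 < y) (n : ℕ) : ∃ x, 1 < x ∧ x ^ n < y := by
  have hpow : ∀ q : ℚ, (toLex ((1 : G), Multiplicative.ofAdd q) : G ×ₗ Multiplicative ℚ) ^ n =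
      toLex (1, Multiplicative.ofAdd (n * q)) := fun q => by
    rw [← nsmul_eq_mul, ofAdd_nsmul, ← toLex_pow, Prod.pow_mk, one_pow]
  rcases Prod.Lex.lt_iff.1 hy with h | ⟨h₁, h₂⟩
  · refine ⟨toLex (1, Multiplicative.ofAdd 1), ?_, ?_⟩
    · exact Prod.Lex.lt_iff.2 (Or.inr ⟨rfl, zero_lt_one (α := ℚ)⟩)
    · rw [hpow]
      exact Prod.Lex.lt_iff.2 (Or.inl h)
  · obtain ⟨q, hq⟩ : ∃ q : ℚ, Multiplicative.ofAdd q = (ofLex y).2 := ⟨_, rfl⟩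
    have hq0 : 0 < q := by
      rw [← hq] at h₂
      exact h₂
    have hn : (0 : ℚ) < n + 1 := by positivity
    refine ⟨toLex (1, Multiplicative.ofAdd (q / (n + 1))), ?_, ?_⟩
    · exact Prod.Lex.lt_iff.2 (Or.inr ⟨rfl, div_pos hq0 hn⟩)
    · rw [hpow]
      refine Prod.Lex.lt_iff.2 (Or.inr ⟨h₁, ?_⟩)
      rw [← hq]
      change (n : ℚ) * (q / (n + 1)) < q
      rw [← mul_div_assoc, div_lt_iff₀ hn]
      linarith

end LexRat

/-- Every countable group with a bi-invariant linear order embeds order-preservingly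
into a countable strongly dense group with a bi-invariant linear order. -/
theorem countable_bi_ordered_embeds_into_strongly_dense
    (G : Type) [Group G] [LinearOrder G] [Countable G]
    (hl : ∀ x y z : G, x < y → z * x < z * y)
    (hr : ∀ x y z : G, x < y → x * z < y * z) :
    ∃ H : CountableBiOrderedGroup, StronglyDense H.carrier ∧
      ∃ φ : G →* H.carrier, Function.Injective φ ∧
        ∀ x y : G, x < y → φ x < φ y := by
  have : MulLeftStrictMono G := ⟨fun z x y h => hl x y z h⟩
  have : MulRightStrictMono G := ⟨fun z x y h => hr x y z h⟩
  have : MulLeftMono G := covariantClass_le_of_lt G G (· * ·)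
  have : MulRightMono G := covariantClass_le_of_lt G G (Function.swap (· * ·))
  let K := NatUltrapower (G ×ₗ Multiplicative ℚ)
  have : Nontrivial (G ×ₗ Multiplicative ℚ) :=
    inferInstanceAs (Nontrivial (G × Multiplicative ℚ))
  have hK : StronglyDense K := stronglyDense_germ (G := G ×ₗ Multiplicative ℚ) lexRat_exists_pow_lt
  let ψ : G →* K :=
    { toFun := fun g => ((toLex (g, 1) : G ×ₗ Multiplicative ℚ) : K)
      map_one' := rfl
      map_mul' := fun x y =>
        congrArg (fun q : Multiplicative ℚ => ((toLex (x * y, q) : G ×ₗ Multiplicative ℚ) : K))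
          (mul_one 1).symm }
  have hψ : ∀ x y : G, x < y → ψ x < ψ y := fun x y h =>
    Filter.Germ.const_lt (Prod.Lex.lt_iff.2 (Or.inl h))
  obtain ⟨H, hHc, hSH, hH⟩ := hK.exists_countable_subgroup (Set.countable_range ψ)
  refine ⟨{ carrier := H
            mul_lt_mul_left' := fun x y z h => germ_mul_lt_mul_left (x : K) y z h
            mul_lt_mul_right' := fun x y z h => germ_mul_lt_mul_right (x : K) y z h }, hH,
    ψ.codRestrict H fun g => hSH ⟨g, rfl⟩, ?_, hψ⟩
  have hmono : StrictMono ψ := fun x y h => hψ x y h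
  exact fun x y h => hmono.injective (congrArg Subtype.val h)
end
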